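/- arXiv:math/0612698 — 2 statements merged into one kernel-verified Lean document; each statement's English description precedes it below -/
import Mathlib

section
/- For every integer N ≥ 1, every α ∈ (0,2) and every ξ ∈ ℝ^N, the lattice approximation of the hypersingular integral converges to the symbol: lim_{h→0⁺} b(α) · h^{−α} · Σ_{k∈ℤ^N, k≠0} (2cos(h·(k·ξ)) − 2)/|k|^{N+α} = −|ξ|^α. -/
open MeasureTheory Filter
open scoped Topology

/-- The normalizing constant `b(α)` of the hypersingular integral representation of the
fractional Laplacian `D₀^α = -(-Δ)^{α/2}` in dimension `N`. -/
noncomputable def bConst (N : ℕ) (α : ℝ) : ℝ :=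
  α * Real.Gamma (α / 2) * Real.Gamma (((N : ℝ) + α) / 2) * Real.sin (α * Real.pi / 2) /
    (2 ^ ((2 : ℝ) - α) * Real.pi ^ (1 + (N : ℝ) / 2))

/-- Euclidean norm of a lattice point `k ∈ ℤ^N`. -/
noncomputable def latNorm (N : ℕ) (k : Fin N → ℤ) : ℝ :=
  Real.sqrt (∑ i, ((k i : ℝ)) ^ 2)

/-- Euclidean inner product `k·ξ` of a lattice point `k ∈ ℤ^N` with `ξ ∈ ℝ^N`. -/
noncomputable def latDot (N : ℕ) (k : Fin N → ℤ) (ξ : EuclideanSpace ℝ (Fin N)) : ℝ :=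
  ∑ i, (k i : ℝ) * ξ i


lemma aux_L1 (r s : ℝ) (hr : 0 < r) (hs : 0 < s) :
    ∫⁻ u in Set.Ioi (0:ℝ), ENNReal.ofReal (u ^ (-s - 1) * Real.exp (-(r / u))) =
      ENNReal.ofReal (r ^ (-s) * Real.Gamma s) := by
  have h1 := Real.integral_rpow_mul_exp_neg_mul_Ioi hs hr
  have h2 := integral_comp_rpow_Ioi (fun t : ℝ => t ^ (s - 1) * Real.exp (-(r * t)))
    (p := -1) (by norm_num)
  have h3 : ∫ u in Set.Ioi (0:ℝ), u ^ (-s - 1) * Real.exp (-(r / u)) = r ^ (-s) * Real.Gamma s := by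
    rw [show r ^ (-s) = (1 / r) ^ s by
      rw [one_div, Real.inv_rpow hr.le, Real.rpow_neg hr.le], ← h1, ← h2]
    refine setIntegral_congr_fun measurableSet_Ioi (fun u hu => ?_)
    have hu' : (0:ℝ) < u := hu
    have e1 : u ^ (-s - 1) = u ^ ((-1:ℝ) - 1) * (u ^ (-1:ℝ)) ^ (s - 1) := by
      rw [← Real.rpow_mul hu'.le, ← Real.rpow_add hu']
      congr 1; ring
    simp only [abs_neg, abs_one, one_mul, smul_eq_mul]
    rw [e1, Real.rpow_neg_one u, div_eq_mul_inv]
    ring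
  rw [← h3, ofReal_integral_eq_lintegral_ofReal]
  · refine Integrable.of_integral_ne_zero ?_
    rw [h3]
    have := Real.Gamma_pos_of_pos hs
    positivity
  · refine (ae_restrict_iff' measurableSet_Ioi).2 (ae_of_all _ fun u hu => ?_)
    have hu' : (0:ℝ) < u := hu
    simp only [Pi.zero_apply]
    positivity

lemma aux_L1' (r s : ℝ) (hr : 0 < r) (hs : 0 < s) :
    ∫⁻ u in Set.Ioi (0:ℝ), ENNReal.ofReal (u ^ (s - 1) * Real.exp (-(r * u))) =
      ENNReal.ofReal (r ^ (-s) * Real.Gamma s) := by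
  have h1 := Real.integral_rpow_mul_exp_neg_mul_Ioi hs hr
  rw [show (1 / r) ^ s = r ^ (-s) by
      rw [one_div, Real.inv_rpow hr.le, Real.rpow_neg hr.le]] at h1
  rw [← h1, ofReal_integral_eq_lintegral_ofReal]
  · refine Integrable.of_integral_ne_zero ?_
    rw [h1]
    have := Real.Gamma_pos_of_pos hs
    positivity
  · refine (ae_restrict_iff' measurableSet_Ioi).2 (ae_of_all _ fun u hu => ?_)
    have hu' : (0:ℝ) < u := hu
    simp only [Pi.zero_apply]
    positivity

lemma aux_L3 (a c : ℝ) (ha : 0 < a) (ha1 : a < 1) (hc : 0 ≤ c) :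
    ∫⁻ u in Set.Ioi (0:ℝ), ENNReal.ofReal (u ^ (-a - 1) * (1 - Real.exp (-(c * u)))) =
      ENNReal.ofReal (Real.Gamma (1 - a) * c ^ a / a) := by
  have e1 : ∀ u ∈ Set.Ioi (0:ℝ), ENNReal.ofReal (u ^ (-a - 1) * (1 - Real.exp (-(c * u)))) =
      ∫⁻ v in Set.Ioc 0 c, ENNReal.ofReal (u ^ ((1 - a) - 1) * Real.exp (-(v * u))) := by
    intro u hu
    have hu' : (0:ℝ) < u := hu
    rw [← ofReal_integral_eq_lintegral_ofReal, ← intervalIntegral.integral_of_le hc]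
    · congr 1
      rw [intervalIntegral.integral_const_mul]
      have : ∫ v in (0:ℝ)..c, Real.exp (-(v * u)) = (1 - Real.exp (-(c * u))) / u := by
        have hd : ∀ v ∈ Set.uIcc 0 c, HasDerivAt (fun v => - Real.exp (-(v * u)) / u)
            (Real.exp (-(v * u))) v := by
          intro v _
          have := ((((hasDerivAt_id v).mul_const u).neg).exp.neg).div_const u
          refine this.congr_deriv ?_
          simp only [id, Pi.neg_apply, Pi.mul_apply]
          field_simp
        rw [intervalIntegral.integral_eq_sub_of_hasDerivAt hd]
        · simp; ring
        · exact Continuous.intervalIntegrable (by fun_prop) _ _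
      rw [this, show -a - 1 = (1 - a - 1) - 1 by ring, Real.rpow_sub_one hu'.ne']
      ring
    · exact (Continuous.integrableOn_Ioc (by fun_prop))
    · exact ae_of_all _ fun v => by simp only [Pi.zero_apply]; positivity
  rw [setLIntegral_congr_fun measurableSet_Ioi e1, lintegral_lintegral_swap]
  · have e2 : ∀ v ∈ Set.Ioc 0 c, ∫⁻ u in Set.Ioi (0:ℝ),
        ENNReal.ofReal (u ^ ((1 - a) - 1) * Real.exp (-(v * u))) =
        ENNReal.ofReal (v ^ (a - 1) * Real.Gamma (1 - a)) := by
      intro v hv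
      rw [aux_L1' v (1 - a) hv.1 (by linarith), neg_sub]
    rw [setLIntegral_congr_fun measurableSet_Ioc e2, ← ofReal_integral_eq_lintegral_ofReal,
      ← intervalIntegral.integral_of_le hc]
    · congr 1
      rw [intervalIntegral.integral_mul_const, integral_rpow (Or.inl (by linarith))]
      simp [Real.zero_rpow ha.ne']
      ring
    · exact ((intervalIntegrable_iff_integrableOn_Ioc_of_le hc).1
        (intervalIntegral.intervalIntegrable_rpow' (by linarith))).mul_const _
    · refine (ae_restrict_iff' measurableSet_Ioc).2 (ae_of_all _ fun u hu => ?_)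
      have hu' : (0:ℝ) < u := hu.1
      have := Real.Gamma_pos_of_pos (show 0 < 1 - a by linarith)
      simp only [Pi.zero_apply]
      positivity
  · apply Measurable.aemeasurable
    fun_prop

lemma aux_L2 (N : ℕ) (ξ : EuclideanSpace ℝ (Fin N)) (u : ℝ) (hu : 0 < u) :
    ∫⁻ y : EuclideanSpace ℝ (Fin N),
      ENNReal.ofReal ((2 - 2 * Real.cos (inner ℝ ξ y)) * Real.exp (-(‖y‖ ^ 2 / u))) =
    ENNReal.ofReal ((Real.pi * u) ^ ((N:ℝ) / 2) * (2 * (1 - Real.exp (-(‖ξ‖ ^ 2 / 4 * u))))) := by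
  have hb : 0 < ((u⁻¹ : ℝ) : ℂ).re := by simpa using hu
  have key : ∀ w : EuclideanSpace ℝ (Fin N),
      Integrable (fun y : EuclideanSpace ℝ (Fin N) =>
        Real.exp (-(‖y‖ ^ 2 / u)) * Real.cos (inner ℝ w y)) ∧
      ∫ y : EuclideanSpace ℝ (Fin N), Real.exp (-(‖y‖ ^ 2 / u)) * Real.cos (inner ℝ w y) =
        (Real.pi * u) ^ ((N:ℝ) / 2) * Real.exp (-(‖w‖ ^ 2 / 4 * u)) := by
    intro w
    have hi := GaussianFourier.integrable_cexp_neg_mul_sq_norm_add hb Complex.I w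
    have hv := GaussianFourier.integral_cexp_neg_mul_sq_norm_add hb Complex.I w
    have e : ∀ y : EuclideanSpace ℝ (Fin N),
        (Complex.exp (-((u⁻¹ : ℝ) : ℂ) * ‖y‖ ^ 2 + Complex.I * (inner ℝ w y : ℝ))).re =
        Real.exp (-(‖y‖ ^ 2 / u)) * Real.cos (inner ℝ w y) := by
      intro y
      rw [Complex.exp_re]
      have h1 : (-((u⁻¹ : ℝ) : ℂ) * ‖y‖ ^ 2 + Complex.I * (inner ℝ w y : ℝ)) =
        ((-(‖y‖ ^ 2 / u) : ℝ) : ℂ) + ((inner ℝ w y : ℝ) : ℂ) * Complex.I := by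
        push_cast; ring
      rw [h1]
      rw [Complex.add_re, Complex.add_im, Complex.re_ofReal_mul, Complex.im_ofReal_mul]
      simp only [Complex.ofReal_re, Complex.ofReal_im, Complex.I_re, Complex.I_im]
      simp
    refine ⟨(hi.re).congr (ae_of_all _ e), ?_⟩
    have h2 := congrArg Complex.re hv
    have h3 := integral_re hi
    have h4 : ∫ y : EuclideanSpace ℝ (Fin N), Real.exp (-(‖y‖ ^ 2 / u)) * Real.cos (inner ℝ w y) =
        ∫ y : EuclideanSpace ℝ (Fin N), RCLike.re
          (Complex.exp (-((u⁻¹ : ℝ) : ℂ) * ‖y‖ ^ 2 + Complex.I * (inner ℝ w y : ℝ))) :=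
      integral_congr_ae (ae_of_all _ fun y => (e y).symm)
    rw [h4, h3]
    refine h2.trans ?_
    have h5 : ((Real.pi : ℂ) / ((u⁻¹ : ℝ) : ℂ)) ^
        ((Module.finrank ℝ (EuclideanSpace ℝ (Fin N)) : ℂ) / 2) *
        Complex.exp (Complex.I ^ 2 * ‖w‖ ^ 2 / (4 * ((u⁻¹ : ℝ) : ℂ))) =
        (((Real.pi * u) ^ ((N:ℝ) / 2) * Real.exp (-(‖w‖ ^ 2 / 4 * u)) : ℝ) : ℂ) := by
      rw [Complex.ofReal_mul, Complex.ofReal_cpow (by positivity), Complex.ofReal_exp]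
      congr 2
      · push_cast; field_simp
      · simp
      · have : (u : ℂ) ≠ 0 := by exact_mod_cast hu.ne'
        push_cast; rw [Complex.I_sq]; field_simp
    rw [h5, Complex.ofReal_re]
  have k0 := key 0
  have k1 := key ξ
  simp only [inner_zero_left, Real.cos_zero, mul_one, norm_zero] at k0
  have e : ∀ y : EuclideanSpace ℝ (Fin N),
      (2 - 2 * Real.cos (inner ℝ ξ y)) * Real.exp (-(‖y‖ ^ 2 / u)) =
      2 * Real.exp (-(‖y‖ ^ 2 / u)) - 2 * (Real.exp (-(‖y‖ ^ 2 / u)) * Real.cos (inner ℝ ξ y)) := by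
    intro y; ring
  have hI : Integrable (fun y : EuclideanSpace ℝ (Fin N) =>
      (2 - 2 * Real.cos (inner ℝ ξ y)) * Real.exp (-(‖y‖ ^ 2 / u))) := by
    simp only [e]
    exact (k0.1.const_mul 2).sub (k1.1.const_mul 2)
  rw [← ofReal_integral_eq_lintegral_ofReal hI]
  · congr 1
    simp only [e]
    rw [integral_sub (k0.1.const_mul 2) (k1.1.const_mul 2), integral_const_mul, integral_const_mul,
      k0.2, k1.2]
    simp
    ring
  · refine ae_of_all _ fun y => ?_
    have := Real.cos_le_one (inner ℝ ξ y)
    simp only [Pi.zero_apply]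
    have := Real.exp_pos (-(‖y‖ ^ 2 / u))
    apply mul_nonneg <;> linarith

lemma aux_value_l (N : ℕ) (hN : 1 ≤ N) (α : ℝ) (hα : α ∈ Set.Ioo (0 : ℝ) 2)
    (ξ : EuclideanSpace ℝ (Fin N)) :
    ENNReal.ofReal (Real.Gamma (((N:ℝ) + α) / 2)) *
    ∫⁻ y : EuclideanSpace ℝ (Fin N),
      ENNReal.ofReal ((2 - 2 * Real.cos (inner ℝ ξ y)) / ‖y‖ ^ ((N:ℝ) + α)) =
    ENNReal.ofReal (2 * Real.pi ^ ((N:ℝ) / 2) *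
      (Real.Gamma (1 - α / 2) * (‖ξ‖ ^ 2 / 4) ^ (α / 2) / (α / 2))) := by
  obtain ⟨h0, h2⟩ := hα
  have hs : 0 < ((N:ℝ) + α) / 2 := by positivity
  have hΓ := Real.Gamma_pos_of_pos hs
  have hnn : ∀ y : EuclideanSpace ℝ (Fin N), 0 ≤ 2 - 2 * Real.cos (inner ℝ ξ y) := fun y => by
    linarith [Real.cos_le_one (inner ℝ ξ y)]
  rw [← lintegral_const_mul _ (by fun_prop)]
  have e1 : ∀ y : EuclideanSpace ℝ (Fin N), ENNReal.ofReal (Real.Gamma (((N:ℝ) + α) / 2)) *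
      ENNReal.ofReal ((2 - 2 * Real.cos (inner ℝ ξ y)) / ‖y‖ ^ ((N:ℝ) + α)) =
      ∫⁻ u in Set.Ioi (0:ℝ), ENNReal.ofReal (u ^ (-(((N:ℝ) + α) / 2) - 1)) *
        ENNReal.ofReal ((2 - 2 * Real.cos (inner ℝ ξ y)) * Real.exp (-(‖y‖ ^ 2 / u))) := by
    intro y
    rcases eq_or_ne y 0 with rfl | hy
    · simp
    have hy' : 0 < ‖y‖ := norm_pos_iff.2 hy
    have e2 : ∀ u ∈ Set.Ioi (0:ℝ), ENNReal.ofReal (u ^ (-(((N:ℝ) + α) / 2) - 1)) *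
        ENNReal.ofReal ((2 - 2 * Real.cos (inner ℝ ξ y)) * Real.exp (-(‖y‖ ^ 2 / u))) =
        ENNReal.ofReal (2 - 2 * Real.cos (inner ℝ ξ y)) * ENNReal.ofReal
          (u ^ (-(((N:ℝ) + α) / 2) - 1) * Real.exp (-(‖y‖ ^ 2 / u))) := by
      intro u hu
      have hu' : (0:ℝ) < u := hu
      rw [← ENNReal.ofReal_mul (by positivity), ← ENNReal.ofReal_mul (hnn y)]
      congr 1; ring
    rw [setLIntegral_congr_fun measurableSet_Ioi e2, lintegral_const_mul _ (by fun_prop),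
      aux_L1 _ _ (by positivity) hs, ← ENNReal.ofReal_mul hΓ.le, ← ENNReal.ofReal_mul (hnn y)]
    congr 1
    have : (‖y‖ ^ 2) ^ (-(((N:ℝ) + α) / 2)) = (‖y‖ ^ ((N:ℝ) + α))⁻¹ := by
      rw [← Real.rpow_natCast, ← Real.rpow_mul hy'.le, ← Real.rpow_neg hy'.le]
      congr 1; push_cast; ring
    rw [this]; ring
  simp_rw [e1]
  rw [lintegral_lintegral_swap]
  · have e3 : ∀ u ∈ Set.Ioi (0:ℝ), ∫⁻ y : EuclideanSpace ℝ (Fin N),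
        ENNReal.ofReal (u ^ (-(((N:ℝ) + α) / 2) - 1)) *
        ENNReal.ofReal ((2 - 2 * Real.cos (inner ℝ ξ y)) * Real.exp (-(‖y‖ ^ 2 / u))) =
        ENNReal.ofReal (2 * Real.pi ^ ((N:ℝ) / 2)) *
        ENNReal.ofReal (u ^ (-(α / 2) - 1) * (1 - Real.exp (-(‖ξ‖ ^ 2 / 4 * u)))) := by
      intro u hu
      have hu' : (0:ℝ) < u := hu
      rw [lintegral_const_mul _ (by fun_prop), aux_L2 N ξ u hu, ← ENNReal.ofReal_mul (by positivity),
        ← ENNReal.ofReal_mul (by positivity)]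
      congr 1
      have : u ^ (-(α / 2) - 1) = u ^ (-(((N:ℝ) + α) / 2) - 1) * u ^ ((N:ℝ) / 2) := by
        rw [← Real.rpow_add hu']; congr 1; ring
      rw [Real.mul_rpow Real.pi_pos.le hu'.le, this]
      ring
    rw [setLIntegral_congr_fun measurableSet_Ioi e3, lintegral_const_mul _ (by fun_prop),
      aux_L3 (α / 2) _ (by linarith) (by linarith) (by positivity),
      ← ENNReal.ofReal_mul (by positivity)]
  · apply Measurable.aemeasurable
    fun_prop

lemma aux_value (N : ℕ) (hN : 1 ≤ N) (α : ℝ) (hα : α ∈ Set.Ioo (0 : ℝ) 2)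
    (ξ : EuclideanSpace ℝ (Fin N)) :
    bConst N α * ∫ y : EuclideanSpace ℝ (Fin N),
      ((2 * Real.cos (inner ℝ ξ y) - 2) / ‖y‖ ^ ((N:ℝ) + α)) = -‖ξ‖ ^ α := by
  have hl := aux_value_l N hN α hα ξ
  obtain ⟨h0, h2⟩ := hα
  have hs : 0 < ((N:ℝ) + α) / 2 := by positivity
  have hΓ := Real.Gamma_pos_of_pos hs
  have hΓ1 := Real.Gamma_pos_of_pos (show 0 < 1 - α / 2 by linarith)
  have hΓ2 := Real.Gamma_pos_of_pos (show 0 < α / 2 by linarith)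
  have e : ∫ y : EuclideanSpace ℝ (Fin N),
      ((2 * Real.cos (inner ℝ ξ y) - 2) / ‖y‖ ^ ((N:ℝ) + α)) =
      - ∫ y : EuclideanSpace ℝ (Fin N),
      ((2 - 2 * Real.cos (inner ℝ ξ y)) / ‖y‖ ^ ((N:ℝ) + α)) := by
    rw [← integral_neg]
    congr 1; ext y; ring
  rw [e, integral_eq_lintegral_of_nonneg_ae]
  · have h3 := congrArg ENNReal.toReal hl
    rw [ENNReal.toReal_mul, ENNReal.toReal_ofReal hΓ.le, ENNReal.toReal_ofReal (by positivity)] at h3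
    rw [mul_neg, neg_inj]
    set I := (∫⁻ y : EuclideanSpace ℝ (Fin N),
      ENNReal.ofReal ((2 - 2 * Real.cos (inner ℝ ξ y)) / ‖y‖ ^ ((N:ℝ) + α))).toReal
    have hr := Real.Gamma_mul_Gamma_one_sub (α / 2)
    have hsin : 0 < Real.sin (α * Real.pi / 2) := by
      apply Real.sin_pos_of_pos_of_lt_pi
      · positivity
      · nlinarith [Real.pi_pos]
    have hx : (‖ξ‖ ^ 2 / 4) ^ (α / 2) = ‖ξ‖ ^ α / 2 ^ α := by
      rw [show ‖ξ‖ ^ 2 / 4 = (‖ξ‖ / 2) ^ (2:ℝ) by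
        rw [Real.rpow_two]; ring, ← Real.rpow_mul (by positivity), Real.div_rpow (by positivity) (by positivity)]
      congr 2 <;> ring
    rw [hx] at h3
    rw [show Real.pi * (α / 2) = α * Real.pi / 2 by ring] at hr
    have hI : I = (2 * Real.pi ^ ((N:ℝ) / 2) *
      (Real.Gamma (1 - α / 2) * (‖ξ‖ ^ α / 2 ^ α) / (α / 2))) / Real.Gamma (((N:ℝ) + α) / 2) := by
      rw [← h3]; field_simp
    have hG : Real.Gamma (α / 2) = Real.pi / Real.sin (α * Real.pi / 2) / Real.Gamma (1 - α / 2) := by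
      rw [← hr]; field_simp
    have hp : Real.pi ^ (1 + (N:ℝ) / 2) = Real.pi * Real.pi ^ ((N:ℝ) / 2) := by
      rw [Real.rpow_add Real.pi_pos, Real.rpow_one]
    have h22 : (2:ℝ) ^ (2 - α) = 4 / 2 ^ α := by
      rw [Real.rpow_sub (by norm_num)]; norm_num
    rw [bConst, hI, hG, hp, h22]
    have : 0 < Real.pi ^ ((N:ℝ) / 2) := by positivity
    have : (0:ℝ) < 2 ^ α := by positivity
    field_simp
    ring
  · refine ae_of_all _ fun y => ?_
    simp only [Pi.zero_apply]
    have := Real.cos_le_one (inner ℝ ξ y)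
    apply div_nonneg
    · linarith
    · positivity
  · apply Measurable.aestronglyMeasurable
    fun_prop

noncomputable def auxLat (N : ℕ) (k : Fin N → ℤ) : EuclideanSpace ℝ (Fin N) :=
  WithLp.toLp 2 (fun i => (k i : ℝ))

noncomputable def auxRnd (N : ℕ) (y : EuclideanSpace ℝ (Fin N)) : Fin N → ℤ :=
  fun i => round (y i)

lemma auxRnd_meas (N : ℕ) : Measurable (auxRnd N) := by
  unfold auxRnd
  simp only [round_eq]
  fun_prop

lemma auxRnd_map (N : ℕ) : Measure.map (auxRnd N) volume = Measure.count := by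
  rw [Measure.ext_iff_singleton]
  intro k
  rw [Measure.map_apply (auxRnd_meas N) (measurableSet_singleton k), Measure.count_singleton]
  have e : auxRnd N ⁻¹' {k} = WithLp.ofLp ⁻¹'
      (Set.univ.pi fun i => Set.Ico ((k i : ℝ) - 1 / 2) ((k i : ℝ) + 1 / 2)) := by
    ext y
    simp only [Set.mem_preimage, Set.mem_singleton_iff, Set.mem_pi, Set.mem_univ, true_imp_iff,
      ← round_eq_iff, auxRnd, funext_iff]
  rw [e, (PiLp.volume_preserving_ofLp (Fin N)).measure_preimage
    (MeasurableSet.univ_pi fun i => measurableSet_Ico).nullMeasurableSet, Real.volume_pi_Ico]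
  norm_num

lemma auxLat_near (N : ℕ) (u : EuclideanSpace ℝ (Fin N)) :
    ‖auxLat N (auxRnd N u) - u‖ ≤ Real.sqrt N := by
  rw [EuclideanSpace.norm_eq]
  apply Real.sqrt_le_sqrt
  calc ∑ i, ‖(auxLat N (auxRnd N u) - u) i‖ ^ 2 ≤ ∑ i : Fin N, (1:ℝ) := by
        refine Finset.sum_le_sum fun i _ => ?_
        have h := abs_sub_round (u i)
        rw [abs_sub_comm] at h
        have : ‖(auxLat N (auxRnd N u) - u) i‖ ≤ 1 / 2 := h
        nlinarith [norm_nonneg ((auxLat N (auxRnd N u) - u) i)]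
    _ = N := by simp

lemma auxLat_le (N : ℕ) (u : EuclideanSpace ℝ (Fin N)) :
    ‖auxLat N (auxRnd N u)‖ ≤ 2 * ‖u‖ := by
  have h2 : 2 * ‖u‖ = ‖(2:ℝ) • u‖ := by rw [norm_smul]; norm_num
  rw [h2, EuclideanSpace.norm_eq, EuclideanSpace.norm_eq]
  apply Real.sqrt_le_sqrt
  refine Finset.sum_le_sum fun i _ => ?_
  apply pow_le_pow_left₀ (norm_nonneg _)
  have h := abs_sub_round (u i)
  change |((round (u i) : ℤ) : ℝ)| ≤ |2 * u i|
  rw [abs_mul, abs_two]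
  by_cases h0 : round (u i) = 0
  · rw [h0]; simp
  · have h1 : (1:ℝ) ≤ |((round (u i) : ℤ) : ℝ)| := by
      exact_mod_cast Int.one_le_abs h0
    have h3 := abs_sub_abs_le_abs_sub ((round (u i) : ℤ) : ℝ) (u i)
    rw [abs_sub_comm] at h3
    linarith

lemma auxLat_one_le (N : ℕ) (k : Fin N → ℤ) (hk : k ≠ 0) : 1 ≤ ‖auxLat N k‖ := by
  obtain ⟨i, hi⟩ := Function.ne_iff.1 hk
  refine le_trans ?_ (PiLp.norm_apply_le (auxLat N k) i)
  change (1:ℝ) ≤ |((k i : ℤ) : ℝ)|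
  exact_mod_cast Int.one_le_abs hi

lemma auxLat_ge (N : ℕ) (u : EuclideanSpace ℝ (Fin N)) (h : auxRnd N u ≠ 0) :
    ‖u‖ ≤ (1 + Real.sqrt N) * ‖auxLat N (auxRnd N u)‖ := by
  have h1 := auxLat_one_le N _ h
  have h2 := auxLat_near N u
  have h3 := norm_sub_norm_le u (auxLat N (auxRnd N u))
  rw [norm_sub_rev] at h3
  nlinarith [Real.sqrt_nonneg (N:ℝ)]

noncomputable def auxF (N : ℕ) (α : ℝ) (ξ y : EuclideanSpace ℝ (Fin N)) : ℝ :=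
  (2 * Real.cos (inner ℝ ξ y) - 2) / ‖y‖ ^ ((N:ℝ) + α)

noncomputable def auxG (N : ℕ) (α : ℝ) (r : ℝ) : ℝ := min 1 (r ^ 2) / r ^ ((N:ℝ) + α)

lemma auxG_int (N : ℕ) (hN : 1 ≤ N) (α : ℝ) (hα : α ∈ Set.Ioo (0 : ℝ) 2) :
    Integrable (fun y : EuclideanSpace ℝ (Fin N) => auxG N α ‖y‖) := by
  obtain ⟨h0, h2⟩ := hα
  haveI : Nonempty (Fin N) := ⟨⟨0, hN⟩⟩
  rw [integrable_fun_norm_addHaar volume (f := auxG N α)]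
  have hm : Measurable (fun y : ℝ => y ^ (N - 1) • auxG N α y) := by
    unfold auxG
    fun_prop
  have e : ∀ y : ℝ, 0 < y → y ^ (N - 1) • auxG N α y = min 1 (y ^ 2) * y ^ (-1 - α) := by
    intro y hy
    have : y ^ (-1 - α) = y ^ (N - 1) / y ^ ((N:ℝ) + α) := by
      rw [← Real.rpow_natCast, ← Real.rpow_sub hy]
      congr 1
      rw [Nat.cast_sub hN]; push_cast; ring
    rw [this, auxG, smul_eq_mul]; ring
  rw [finrank_euclideanSpace_fin]
  rw [← Set.Ioo_union_Ici_eq_Ioi (zero_lt_one' ℝ), integrableOn_union]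
  constructor
  · refine Integrable.mono' ((intervalIntegral.integrableOn_Ioo_rpow_iff
      (s := 1 - α) (zero_lt_one' ℝ)).2 (by linarith)) hm.aestronglyMeasurable ?_
    refine (ae_restrict_iff' measurableSet_Ioo).2 (ae_of_all _ fun y hy => ?_)
    have hy0 : 0 < y := hy.1
    rw [e y hy.1, Real.norm_of_nonneg (by positivity)]
    have : y ^ (1 - α) = y ^ 2 * y ^ (-1 - α) := by
      rw [← Real.rpow_natCast, ← Real.rpow_add hy0]; congr 1; push_cast; ring
    rw [this]
    gcongr
    exact min_le_right _ _
  · rw [integrableOn_Ici_iff_integrableOn_Ioi]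
    refine Integrable.mono' (integrableOn_Ioi_rpow_of_lt
      (a := -1 - α) (by linarith) (zero_lt_one' ℝ)) hm.aestronglyMeasurable ?_
    refine (ae_restrict_iff' measurableSet_Ioi).2 (ae_of_all _ fun y hy => ?_)
    have hy0 : 0 < y := lt_trans zero_lt_one hy
    rw [e y hy0, Real.norm_of_nonneg (by positivity)]
    have : 0 < y ^ (-1 - α) := by positivity
    nlinarith [min_le_left 1 (y ^ 2)]

lemma auxF_bound (N : ℕ) (α : ℝ) (hα : 0 < α) (ξ y z : EuclideanSpace ℝ (Fin N)) (C : ℝ)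
    (hC : 0 < C) (h : z = 0 ∨ (‖z‖ ≤ 2 * ‖y‖ ∧ ‖y‖ ≤ C * ‖z‖)) :
    ‖auxF N α ξ z‖ ≤ ((4 + ‖ξ‖ ^ 2) * 4 * C ^ ((N:ℝ) + α)) * auxG N α ‖y‖ := by
  have hG : 0 ≤ auxG N α ‖y‖ := by unfold auxG; positivity
  rcases eq_or_ne z 0 with rfl | hz
  · simp only [auxF, inner_zero_right, Real.cos_zero]
    norm_num
    positivity
  obtain ⟨h1, h2⟩ := h.resolve_left hz
  have hz' : 0 < ‖z‖ := norm_pos_iff.2 hz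
  have hy' : 0 < ‖y‖ := by linarith
  unfold auxF auxG
  rw [norm_div, Real.norm_of_nonneg (by positivity : (0:ℝ) ≤ ‖z‖ ^ ((N:ℝ) + α))]
  have hn : ‖2 * Real.cos (inner ℝ ξ z) - 2‖ ≤ (4 + ‖ξ‖ ^ 2) * min 1 (‖z‖ ^ 2) := by
    have c1 := Real.cos_le_one (inner ℝ ξ z)
    have c2 := Real.neg_one_le_cos (inner ℝ ξ z)
    have c3 := Real.one_sub_sq_div_two_le_cos (x := inner ℝ ξ z)
    have c4 := abs_real_inner_le_norm ξ z
    have c5 : (inner ℝ ξ z : ℝ) ^ 2 ≤ ‖ξ‖ ^ 2 * ‖z‖ ^ 2 := by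
      rw [← sq_abs, ← mul_pow]
      exact pow_le_pow_left₀ (abs_nonneg _) c4 2
    rw [Real.norm_eq_abs, abs_of_nonpos (by linarith)]
    rcases le_total 1 (‖z‖ ^ 2) with hm | hm
    · rw [min_eq_left hm]; nlinarith [sq_nonneg ‖ξ‖]
    · rw [min_eq_right hm]; nlinarith [sq_nonneg ‖ξ‖, sq_nonneg ‖z‖]
  have hm : min 1 (‖z‖ ^ 2) ≤ 4 * min 1 (‖y‖ ^ 2) := by
    rcases le_total 1 (‖y‖ ^ 2) with hm | hm
    · rw [min_eq_left hm]; linarith [min_le_left 1 (‖z‖ ^ 2)]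
    · rw [min_eq_right hm]; nlinarith [min_le_right 1 (‖z‖ ^ 2)]
  have hd : ‖y‖ ^ ((N:ℝ) + α) ≤ C ^ ((N:ℝ) + α) * ‖z‖ ^ ((N:ℝ) + α) := by
    rw [← Real.mul_rpow hC.le hz'.le]
    exact Real.rpow_le_rpow hy'.le h2 (by positivity)
  have hzp : 0 < ‖z‖ ^ ((N:ℝ) + α) := by positivity
  have hyp : 0 < ‖y‖ ^ ((N:ℝ) + α) := by positivity
  rw [← mul_div_assoc, div_le_div_iff₀ hzp hyp]
  calc ‖2 * Real.cos (inner ℝ ξ z) - 2‖ * ‖y‖ ^ ((N:ℝ) + α)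
      ≤ ((4 + ‖ξ‖ ^ 2) * (4 * min 1 (‖y‖ ^ 2))) * (C ^ ((N:ℝ) + α) * ‖z‖ ^ ((N:ℝ) + α)) := by
        gcongr
        exact hn.trans (by gcongr)
    _ = _ := by ring

noncomputable def auxZ (N : ℕ) (h : ℝ) (y : EuclideanSpace ℝ (Fin N)) : EuclideanSpace ℝ (Fin N) :=
  h • auxLat N (auxRnd N (h⁻¹ • y))

lemma auxZ_bound (N : ℕ) (h : ℝ) (hh : 0 < h) (y : EuclideanSpace ℝ (Fin N)) :
    auxZ N h y = 0 ∨ (‖auxZ N h y‖ ≤ 2 * ‖y‖ ∧ ‖y‖ ≤ (1 + Real.sqrt N) * ‖auxZ N h y‖) := by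
  have hy : ‖y‖ = h * ‖h⁻¹ • y‖ := by
    rw [norm_smul, Real.norm_of_nonneg (by positivity)]; field_simp
  by_cases h0 : auxRnd N (h⁻¹ • y) = 0
  · left
    unfold auxZ
    rw [h0]
    have : auxLat N 0 = 0 := by ext i; simp [auxLat]
    rw [this, smul_zero]
  · right
    unfold auxZ
    rw [norm_smul, Real.norm_of_nonneg hh.le, hy]
    have h1 := auxLat_le N (h⁻¹ • y)
    have h2 := auxLat_ge N (h⁻¹ • y) h0
    constructor
    · nlinarith
    · nlinarith

lemma auxZ_tendsto (N : ℕ) (y : EuclideanSpace ℝ (Fin N)) :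
    Tendsto (fun h : ℝ => auxZ N h y) (𝓝[>] 0) (𝓝 y) := by
  rw [tendsto_iff_norm_sub_tendsto_zero]
  have ht : Tendsto (fun h : ℝ => h * Real.sqrt N) (𝓝[>] 0) (𝓝 0) := by
    have : Tendsto (fun h : ℝ => h * Real.sqrt N) (𝓝 0) (𝓝 (0 * Real.sqrt N)) :=
      (continuous_id.mul continuous_const).tendsto 0
    rw [zero_mul] at this
    exact this.mono_left nhdsWithin_le_nhds
  refine tendsto_of_tendsto_of_tendsto_of_le_of_le' tendsto_const_nhds ht
    (Eventually.of_forall fun h => norm_nonneg _) ?_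
  filter_upwards [self_mem_nhdsWithin] with h hh
  have hh' : (0:ℝ) < h := hh
  have : auxZ N h y - y = h • (auxLat N (auxRnd N (h⁻¹ • y)) - h⁻¹ • y) := by
    rw [smul_sub, smul_smul, mul_inv_cancel₀ hh'.ne', one_smul, auxZ]
  rw [this, norm_smul, Real.norm_of_nonneg hh'.le]
  exact mul_le_mul_of_nonneg_left (auxLat_near N _) hh'.le

lemma auxF_meas (N : ℕ) (α : ℝ) (ξ : EuclideanSpace ℝ (Fin N)) : Measurable (auxF N α ξ) := by
  unfold auxF
  fun_prop

lemma auxZ_meas (N : ℕ) (h : ℝ) : Measurable (auxZ N h) := by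
  unfold auxZ
  have h1 : Measurable (auxLat N) := measurable_of_countable _
  exact (h1.comp ((auxRnd_meas N).comp (measurable_const_smul h⁻¹))).const_smul h

lemma auxF_tendsto (N : ℕ) (hN : 1 ≤ N) (α : ℝ) (hα : α ∈ Set.Ioo (0 : ℝ) 2)
    (ξ : EuclideanSpace ℝ (Fin N)) :
    Tendsto (fun h : ℝ => ∫ y, auxF N α ξ (auxZ N h y)) (𝓝[>] 0) (𝓝 (∫ y, auxF N α ξ y)) := by
  haveI : Nonempty (Fin N) := ⟨⟨0, hN⟩⟩
  have hC : 0 < 1 + Real.sqrt N := by positivity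
  refine tendsto_integral_filter_of_dominated_convergence
    (fun y => ((4 + ‖ξ‖ ^ 2) * 4 * (1 + Real.sqrt N) ^ ((N:ℝ) + α)) * auxG N α ‖y‖) ?_ ?_ ?_ ?_
  · exact Eventually.of_forall fun h => ((auxF_meas N α ξ).comp (auxZ_meas N h)).aestronglyMeasurable
  · filter_upwards [self_mem_nhdsWithin] with h hh
    exact ae_of_all _ fun y => auxF_bound N α hα.1 ξ y _ _ hC (auxZ_bound N h hh y)
  · exact (auxG_int N hN α hα).const_mul _
  · have : ∀ᵐ y : EuclideanSpace ℝ (Fin N), y ≠ 0 := by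
      rw [ae_iff]; simp
    filter_upwards [this] with y hy
    have hc : ContinuousAt (auxF N α ξ) y := by
      unfold auxF
      have hy' : ‖y‖ ≠ 0 := norm_ne_zero_iff.2 hy
      refine ContinuousAt.div (by fun_prop) ?_ ?_
      · exact continuous_norm.continuousAt.rpow_const (Or.inl hy')
      · exact (Real.rpow_pos_of_pos (norm_pos_iff.2 hy) _).ne'
    exact hc.tendsto.comp (auxZ_tendsto N y)

lemma auxF_sum (N : ℕ) (hN : 1 ≤ N) (α : ℝ) (hα : α ∈ Set.Ioo (0 : ℝ) 2)
    (ξ : EuclideanSpace ℝ (Fin N)) (h : ℝ) (hh : 0 < h) :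
    ∫ y, auxF N α ξ (auxZ N h y) = h ^ (-α) * ∑' k : {k : Fin N → ℤ // k ≠ 0},
            (2 * Real.cos (h * latDot N k.1 ξ) - 2) / latNorm N k.1 ^ ((N : ℝ) + α) := by
  have hC : 0 < 1 + Real.sqrt N := by positivity
  have hI : Integrable (fun y => auxF N α ξ (auxZ N h y)) :=
    Integrable.mono' ((auxG_int N hN α hα).const_mul _)
      ((auxF_meas N α ξ).comp (auxZ_meas N h)).aestronglyMeasurable
      (ae_of_all _ fun y => auxF_bound N α hα.1 ξ y _ _ hC (auxZ_bound N h hh y))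
  set g : (Fin N → ℤ) → ℝ := fun k => auxF N α ξ (h • auxLat N k) with hg
  have hgm : Measurable g := measurable_of_countable _
  have hI2 : Integrable (fun u => g (auxRnd N u)) := by
    have := (integrable_comp_smul_iff (volume : Measure (EuclideanSpace ℝ (Fin N)))
      (fun u => g (auxRnd N u)) (inv_ne_zero hh.ne')).1
    exact this hI
  have e1 : ∫ y, auxF N α ξ (auxZ N h y) = h ^ N * ∫ u, g (auxRnd N u) := by
    have := Measure.integral_comp_inv_smul_of_nonneg
      (volume : Measure (EuclideanSpace ℝ (Fin N))) (fun u => g (auxRnd N u)) hh.le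
    rw [finrank_euclideanSpace_fin, smul_eq_mul] at this
    exact this
  have hI3 : Integrable g Measure.count := by
    rw [← auxRnd_map]
    exact (integrable_map_measure hgm.aestronglyMeasurable (auxRnd_meas N).aemeasurable).2 hI2
  have e2 : ∫ u, g (auxRnd N u) = ∑' k, g k := by
    rw [← integral_map (auxRnd_meas N).aemeasurable hgm.aestronglyMeasurable, auxRnd_map,
      integral_countable hI3]
    simp [Measure.real]
  have e3 : ∑' k, g k = ∑' k : {k : Fin N → ℤ // k ≠ 0}, g k.1 := by
    symm
    apply tsum_subtype_eq_of_support_subset (f := g) (s := {k | k ≠ 0})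
    intro k hk hk0
    apply hk
    have : auxLat N 0 = 0 := by ext i; simp [auxLat]
    rw [hg]
    simp [hk0, this, auxF]
  rw [e1, e2, e3, ← tsum_mul_left, ← tsum_mul_left]
  refine tsum_congr fun k => ?_
  have d1 : (inner ℝ ξ (h • auxLat N k.1) : ℝ) = h * latDot N k.1 ξ := by
    rw [inner_smul_right, PiLp.inner_apply, latDot]
    rfl
  have d2 : ‖auxLat N k.1‖ = latNorm N k.1 := by
    rw [EuclideanSpace.norm_eq, latNorm]
    simp [auxLat]
  rw [hg]
  simp only [auxF]
  rw [d1, norm_smul, d2, Real.norm_of_nonneg hh.le,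
    Real.mul_rpow hh.le (by unfold latNorm; positivity), Real.rpow_add hh, Real.rpow_natCast,
    Real.rpow_neg hh.le]
  have : 0 < h ^ α := by positivity
  have : 0 < h ^ N := by positivity
  field_simp

/-- The lattice (rectangular cubature) approximation of the hypersingular integral converges
to the symbol: `b(α) h^{-α} ∑_{k ≠ 0} (2cos(h k·ξ) - 2)/|k|^{N+α} → -|ξ|^α` as `h → 0⁺`. -/
theorem stmt_2 (N : ℕ) (hN : 1 ≤ N) (α : ℝ) (hα : α ∈ Set.Ioo (0 : ℝ) 2)
    (ξ : EuclideanSpace ℝ (Fin N)) :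
    Tendsto (fun h : ℝ =>
        bConst N α * h ^ (-α) *
          ∑' k : {k : Fin N → ℤ // k ≠ 0},
            (2 * Real.cos (h * latDot N k.1 ξ) - 2) / latNorm N k.1 ^ ((N : ℝ) + α))
      (𝓝[>] 0) (𝓝 (-‖ξ‖ ^ α)) := by
  have h1 := (auxF_tendsto N hN α hα ξ).const_mul (bConst N α)
  have h2 : bConst N α * ∫ y, auxF N α ξ y = -‖ξ‖ ^ α := aux_value N hN α hα ξ
  rw [h2] at h1
  refine h1.congr' ?_
  filter_upwards [self_mem_nhdsWithin] with h hh
  rw [auxF_sum N hN α hα ξ h hh, mul_assoc]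
end

section
/- Let N ≥ 1 be an integer and let a : ℝ → ℝ be measurable, nonnegative, vanishing outside the interval (0,2), and Lebesgue integrable. Then for every ξ ∈ ℝ^N, lim_{h→0⁺} ∫₀² a(α) · b(α) · h^{−α} · ( Σ_{k∈ℤ^N, k≠0} (2cos(h·(k·ξ)) − 2)/|k|^{N+α} ) dα = −∫₀² a(α)·|ξ|^α dα. -/
open MeasureTheory Filter
open scoped Topology

lemma hasSum_mul_aux {ι κ : Type} (f : ι → ℂ) (g : κ → ℂ) {t : ℂ} (hf : Summable fun n => ‖f n‖)
    (hg : Summable fun n => ‖g n‖) (hgt : HasSum g t) :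
    HasSum (fun x : ι × κ => f x.1 * g x.2) ((∑' n, f n) * t) :=
  HasSum.mul hf.of_norm.hasSum hgt (summable_mul_of_summable_norm hf hg)

/-- Product of sums over a lattice. -/
lemma hasSum_pi_prod (N : ℕ) (f : Fin N → ℤ → ℂ) (hf : ∀ i, Summable fun n => ‖f i n‖) :
    (Summable fun k : Fin N → ℤ => ‖∏ i, f i (k i)‖) ∧
      HasSum (fun k : Fin N → ℤ => ∏ i, f i (k i)) (∏ i, ∑' n, f i n) := by
  induction N with
  | zero =>
    constructor
    · exact Summable.of_finite
    · simp
  | succ N ih =>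
    obtain ⟨h1, h2⟩ := ih (fun i => f i.succ) (fun i => hf i.succ)
    generalize hg : (fun k : Fin N → ℤ => ∏ i, f i.succ (k i)) = g at h2
    have h1' : Summable fun k => ‖g k‖ := by rw [← hg]; exact h1
    constructor
    · rw [← (Fin.consEquiv (fun _ : Fin (N + 1) => ℤ)).summable_iff]
      have := (hf 0).mul_of_nonneg h1 (fun _ => norm_nonneg _) (fun _ => norm_nonneg _)
      refine this.congr ?_
      intro x
      simp [Fin.consEquiv, Fin.prod_univ_succ]
    · rw [← (Fin.consEquiv (fun _ : Fin (N + 1) => ℤ)).hasSum_iff, Fin.prod_univ_succ]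
      have := hasSum_mul_aux (f 0) g (hf 0) h1' h2
      refine Eq.mp ?_ this
      congr 1
      ext x
      simp [Fin.consEquiv, Fin.prod_univ_succ, ← hg]

lemma summable_gauss1 {s : ℝ} (hs : 0 < s) : Summable fun n : ℤ => Real.exp (-s * (n : ℝ) ^ 2) := by
  have h0 : Summable fun n : ℕ => Real.exp (-s * (n : ℝ) ^ 2) := by
    have := Real.summable_exp_nat_mul_iff.2 (show -s < 0 by linarith)
    refine Summable.of_nonneg_of_le (fun _ => (Real.exp_pos _).le) ?_ this
    intro n
    rw [Real.exp_le_exp]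
    have : (n : ℝ) ≤ (n : ℝ) ^ 2 := by exact_mod_cast Nat.le_self_pow (by norm_num) n
    nlinarith
  refine Summable.of_nat_of_neg ?_ ?_
  · simpa using h0
  · simpa using h0

/-- squared norm of lattice vectors -/
noncomputable def qf (N : ℕ) (k : Fin N → ℤ) : ℝ := ∑ i, ((k i : ℝ)) ^ 2

lemma qf_nonneg (N : ℕ) (k : Fin N → ℤ) : 0 ≤ qf N k := Finset.sum_nonneg fun _ _ => sq_nonneg _

lemma one_le_qf (N : ℕ) (k : Fin N → ℤ) (hk : k ≠ 0) : 1 ≤ qf N k := by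
  obtain ⟨i, hi⟩ := Function.ne_iff.1 hk
  have h1 : (1 : ℝ) ≤ (k i : ℝ) ^ 2 := by
    have : (1 : ℤ) ≤ (k i) ^ 2 := by
      have : 0 < (k i) ^ 2 := by have : k i ≠ 0 := hi
                                 positivity
      omega
    exact_mod_cast this
  exact h1.trans (Finset.single_le_sum (f := fun i => (k i : ℝ) ^ 2) (fun _ _ => sq_nonneg _) (Finset.mem_univ i))

noncomputable def T1 (s : ℝ) : ℝ := ∑' n : ℤ, Real.exp (-s * (n : ℝ) ^ 2)

lemma hasSum_gaussN (N : ℕ) {s : ℝ} (hs : 0 < s) :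
    HasSum (fun k : Fin N → ℤ => Real.exp (-s * qf N k)) (T1 s ^ N) := by
  have h := (hasSum_pi_prod N (fun _ n => ((Real.exp (-s * (n : ℝ) ^ 2) : ℝ) : ℂ)) (fun _ => by
    refine (summable_gauss1 hs).congr fun n => ?_
    rw [Complex.norm_real, Real.norm_of_nonneg (Real.exp_pos _).le])).2
  rw [← Complex.hasSum_ofReal]
  convert h using 1
  · ext k
    rw [← Complex.ofReal_prod, ← Real.exp_sum, qf, Finset.mul_sum]
  · simp [T1, Complex.ofReal_tsum]

lemma T1_nonneg (s : ℝ) : 0 ≤ T1 s := tsum_nonneg fun _ => (Real.exp_pos _).le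

lemma T1_bound {s : ℝ} (hs : 0 < s) (hs1 : s ≤ 1) :
    T1 s ≤ (Real.sqrt Real.pi * T1 1) * s ^ (-(1 / 2) : ℝ) := by
  have hp := Real.pi_pos
  have h := Real.tsum_exp_neg_mul_int_sq (a := s / Real.pi) (by positivity)
  have e1 : T1 s = ∑' n : ℤ, Real.exp (-Real.pi * (s / Real.pi) * (n : ℝ) ^ 2) := by
    unfold T1; congr 1; ext n; congr 2; field_simp
  rw [e1, h]
  have h2 : ∑' n : ℤ, Real.exp (-Real.pi / (s / Real.pi) * (n : ℝ) ^ 2) ≤ T1 1 := by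
    have hpos : 0 < Real.pi / (s / Real.pi) := by positivity
    refine Summable.tsum_le_tsum ?_ ?_ (summable_gauss1 one_pos)
    · intro n
      rw [Real.exp_le_exp]
      have : 1 ≤ Real.pi / (s / Real.pi) := by
        rw [le_div_iff₀ (by positivity), one_mul, div_le_iff₀ hp]
        nlinarith [Real.pi_gt_three]
      rw [neg_div]
      nlinarith [sq_nonneg (n : ℝ)]
    · have := summable_gauss1 hpos
      simpa [neg_div] using this
  have h3 : 1 / (s / Real.pi) ^ (1 / 2 : ℝ) = Real.sqrt Real.pi * s ^ (-(1 / 2) : ℝ) := by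
    rw [Real.div_rpow hs.le hp.le, Real.rpow_neg hs.le, ← Real.sqrt_eq_rpow Real.pi]
    field_simp
  rw [h3]
  have : 0 ≤ Real.sqrt Real.pi * s ^ (-(1 / 2) : ℝ) := by positivity
  nlinarith

lemma gaussN_bound (N : ℕ) : ∃ C : ℝ, 0 ≤ C ∧ ∀ s : ℝ, 0 < s →
    ∑' k : {k : Fin N → ℤ // k ≠ 0}, Real.exp (-s * qf N k.1) ≤ C * s ^ (-(N : ℝ) / 2) := by
  have hT := T1_nonneg 1
  refine ⟨(Real.sqrt Real.pi * T1 1) ^ N + N.factorial * Real.exp 1 * T1 1 ^ N, by positivity, ?_⟩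
  intro s hs
  have hsum := fun {s : ℝ} (hs : 0 < s) => (hasSum_gaussN N hs)
  have hsub : ∀ {s : ℝ}, 0 < s → ∑' k : {k : Fin N → ℤ // k ≠ 0}, Real.exp (-s * qf N k.1) ≤ T1 s ^ N := by
    intro s hs
    rw [← (hsum hs).tsum_eq]
    exact Summable.tsum_subtype_le _ {k | k ≠ 0} (fun _ => (Real.exp_pos _).le) (hsum hs).summable
  have hsp : 0 < s ^ (-(N : ℝ) / 2) := by positivity
  rcases le_total s 1 with h1 | h1
  · calc _ ≤ T1 s ^ N := hsub hs
      _ ≤ ((Real.sqrt Real.pi * T1 1) * s ^ (-(1 / 2) : ℝ)) ^ N :=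
          pow_le_pow_left₀ (T1_nonneg s) (T1_bound hs h1) N
      _ = (Real.sqrt Real.pi * T1 1) ^ N * s ^ (-(N : ℝ) / 2) := by
          rw [mul_pow _ _ N, ← Real.rpow_mul_natCast hs.le]; congr 2; ring
      _ ≤ _ := by
          apply mul_le_mul_of_nonneg_right _ hsp.le
          have : 0 ≤ N.factorial * Real.exp 1 * T1 1 ^ N := by positivity
          linarith
  · have hA : ∑' k : {k : Fin N → ℤ // k ≠ 0}, Real.exp (-s * qf N k.1) ≤
        ∑' k : {k : Fin N → ℤ // k ≠ 0}, Real.exp (1 - s) * Real.exp (-1 * qf N k.1) := by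
      refine Summable.tsum_le_tsum ?_ ((hsum hs).summable.subtype {k | k ≠ 0})
        (((hsum one_pos).summable.subtype {k | k ≠ 0}).mul_left _)
      intro k
      rw [← Real.exp_add, Real.exp_le_exp]
      nlinarith [one_le_qf N k.1 k.2]
    rw [tsum_mul_left] at hA
    have hB := hsub one_pos
    have hC : Real.exp (1 - s) ≤ N.factorial * Real.exp 1 * s ^ (-(N : ℝ) / 2) := by
      have h2 := Real.pow_div_factorial_le_exp s hs.le N
      have h3 : s ^ ((N : ℝ) / 2) ≤ s ^ N := by
        rw [← Real.rpow_natCast s N]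
        apply Real.rpow_le_rpow_of_exponent_le h1
        have : (0 : ℝ) ≤ N := by positivity
        linarith
      have h4 : s ^ ((N : ℝ) / 2) ≤ N.factorial * Real.exp s := by
        rw [div_le_iff₀ (by positivity)] at h2
        linarith
      rw [Real.exp_sub, neg_div, Real.rpow_neg hs.le, div_le_iff₀ (Real.exp_pos _)]
      have : 0 < s ^ ((N : ℝ) / 2) := by positivity
      field_simp
      linarith
    calc _ ≤ _ := hA
      _ ≤ (N.factorial * Real.exp 1 * s ^ (-(N : ℝ) / 2)) * T1 1 ^ N := by gcongr
      _ ≤ _ := by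
        have : 0 ≤ (Real.sqrt Real.pi * T1 1) ^ N * s ^ (-(N : ℝ) / 2) := by positivity
        linarith

lemma measurable_tsum_nonneg {ι : Type} [Countable ι] (f : ι → ℝ → ℝ) (h0 : ∀ i x, 0 ≤ f i x)
    (hm : ∀ i, Measurable (f i)) : Measurable fun x => ∑' i, f i x := by
  have : (fun x => ∑' i, f i x) = fun x => (∑' i, ENNReal.ofReal (f i x)).toReal := by
    ext x
    rw [ENNReal.tsum_toReal_eq (fun _ => ENNReal.ofReal_ne_top)]
    congr 1; ext i
    rw [ENNReal.toReal_ofReal (h0 i x)]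
  rw [this]
  exact (Measurable.tsum fun i => (hm i).ennreal_ofReal).ennreal_toReal

lemma theta_bound {x t h : ℝ} (ht : 0 < t) (hh : 0 < h) (hx : h * |x| ≤ Real.pi) (n : ℤ) (hn : n ≠ 0) :
    Real.exp (-(Real.pi ^ 2 / (t * h ^ 2)) * (n - h * x / (2 * Real.pi)) ^ 2) ≤
      Real.exp (-(Real.pi ^ 2 / (4 * t) * (n : ℝ) ^ 2) * (h ^ 2)⁻¹) := by
  have hp := Real.pi_pos
  rw [Real.exp_le_exp]
  have h1 : |h * x / (2 * Real.pi)| ≤ 1 / 2 := by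
    rw [abs_div, abs_mul, abs_of_pos hh, abs_of_pos (by positivity : 0 < 2 * Real.pi), div_le_iff₀ (by positivity)]
    linarith
  have h2 : (1 : ℝ) ≤ |(n : ℝ)| := by
    have := Int.one_le_abs hn
    exact_mod_cast this
  have h3 : |(n : ℝ)| / 2 ≤ |(n : ℝ) - h * x / (2 * Real.pi)| := by
    have := abs_sub_abs_le_abs_sub (n : ℝ) (h * x / (2 * Real.pi))
    linarith
  have h4 : (n : ℝ) ^ 2 / 4 ≤ ((n : ℝ) - h * x / (2 * Real.pi)) ^ 2 := by
    rw [← sq_abs ((n : ℝ) - _), ← sq_abs (n : ℝ)]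
    nlinarith [abs_nonneg (n : ℝ)]
  have h5 : Real.pi ^ 2 / (4 * t) * (n : ℝ) ^ 2 * (h ^ 2)⁻¹ = Real.pi ^ 2 / (t * h ^ 2) * ((n : ℝ) ^ 2 / 4) := by
    field_simp
  have h6 : 0 ≤ Real.pi ^ 2 / (t * h ^ 2) := by positivity
  have := mul_le_mul_of_nonneg_left h4 h6
  linarith

lemma theta_tail (x : ℝ) {t : ℝ} (ht : 0 < t) :
    Tendsto (fun h : ℝ => ∑' n : ℤ, Real.exp (-(Real.pi ^ 2 / (t * h ^ 2)) * (n - h * x / (2 * Real.pi)) ^ 2))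
      (𝓝[>] 0) (𝓝 (Real.exp (-x ^ 2 / (4 * t)))) := by
  have hp := Real.pi_pos
  have e : Real.exp (-x ^ 2 / (4 * t)) = ∑' n : ℤ, if n = 0 then Real.exp (-x ^ 2 / (4 * t)) else 0 := by
    rw [tsum_ite_eq]
  rw [e]
  have hpos : ∀ᶠ h : ℝ in 𝓝[>] 0, 0 < h := self_mem_nhdsWithin
  have hle1 : ∀ᶠ h : ℝ in 𝓝[>] 0, h ≤ 1 :=
    (nhdsWithin_le_nhds) (Iic_mem_nhds one_pos)
  have hsm : ∀ᶠ h : ℝ in 𝓝[>] 0, h * |x| ≤ Real.pi := by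
    apply nhdsWithin_le_nhds
    have : Tendsto (fun h : ℝ => h * |x|) (𝓝 0) (𝓝 (0 * |x|)) := (continuous_mul_const _).tendsto _
    rw [zero_mul] at this
    exact this (Iic_mem_nhds hp)
  refine tendsto_tsum_of_dominated_convergence
    (bound := fun n : ℤ => Real.exp (-(Real.pi ^ 2 / (4 * t)) * (n : ℝ) ^ 2)) (summable_gauss1 (by positivity)) ?_ ?_
  · intro n
    by_cases hn : n = 0
    · subst hn
      simp only [if_true]
      refine tendsto_const_nhds.congr' ?_
      filter_upwards [hpos] with h hh
      congr 1
      push_cast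
      field_simp
      ring
    · simp only [hn, if_false]
      have hlim : Tendsto (fun h : ℝ => Real.exp (-(Real.pi ^ 2 / (4 * t) * (n : ℝ) ^ 2) * (h ^ 2)⁻¹)) (𝓝[>] 0) (𝓝 0) := by
        apply Real.tendsto_exp_atBot.comp
        have hn' : (0 : ℝ) < (n : ℝ) ^ 2 := by
          have : (n : ℝ) ≠ 0 := by exact_mod_cast hn
          positivity
        have h1 : Tendsto (fun h : ℝ => (h ^ 2)⁻¹) (𝓝[>] 0) atTop := by
          have := (tendsto_pow_atTop (α := ℝ) two_ne_zero).comp (tendsto_inv_nhdsGT_zero (𝕜 := ℝ))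
          refine this.congr fun h => ?_
          simp
        exact h1.const_mul_atTop_of_neg (by have : 0 < Real.pi ^ 2 / (4 * t) * (n : ℝ) ^ 2 := by positivity
                                            linarith)
      refine squeeze_zero' (Eventually.of_forall fun _ => (Real.exp_pos _).le) ?_ hlim
      filter_upwards [hpos, hsm] with h hh hs
      exact theta_bound ht hh hs n hn
  · filter_upwards [hpos, hsm, hle1] with h hh hs h1 n
    rw [Real.norm_of_nonneg (Real.exp_pos _).le]
    by_cases hn : n = 0
    · subst hn
      rw [Real.exp_le_exp]
      have : 0 ≤ Real.pi ^ 2 / (t * h ^ 2) * (((0 : ℤ) : ℝ) - h * x / (2 * Real.pi)) ^ 2 := by positivity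
      simp only [Int.cast_zero] at this ⊢
      linarith
    · refine (theta_bound ht hh hs n hn).trans ?_
      rw [Real.exp_le_exp]
      have h2 : 1 ≤ (h ^ 2)⁻¹ := by
        rw [one_le_inv₀ (by positivity)]
        nlinarith
      have h3 : 0 ≤ Real.pi ^ 2 / (4 * t) * (n : ℝ) ^ 2 := by positivity
      nlinarith

noncomputable def TH (x t h : ℝ) (n : ℤ) : ℂ :=
  Complex.exp (((-(t * h ^ 2) * (n : ℝ) ^ 2 : ℝ) : ℂ) + ((n * (h * x) : ℝ) : ℂ) * Complex.I)

lemma TH_norm (x t h : ℝ) (n : ℤ) : ‖TH x t h n‖ = Real.exp (-(t * h ^ 2) * (n : ℝ) ^ 2) := by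
  rw [TH, Complex.norm_exp]
  congr 1
  simp [-Complex.ofReal_mul, -Complex.ofReal_neg, -Complex.ofReal_pow]

lemma TH_tendsto (x : ℝ) {t : ℝ} (ht : 0 < t) :
    Tendsto (fun h : ℝ => (h : ℂ) * ∑' n : ℤ, TH x t h n) (𝓝[>] 0)
      (𝓝 ((Real.sqrt (Real.pi / t) * Real.exp (-x ^ 2 / (4 * t)) : ℝ) : ℂ)) := by
  have hp := Real.pi_pos
  have h1 := (Complex.continuous_ofReal.tendsto _).comp ((theta_tail x ht).const_mul (Real.sqrt (Real.pi / t)))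
  refine h1.congr' ?_
  filter_upwards [self_mem_nhdsWithin] with h hh
  have hh : 0 < h := hh
  have ha : 0 < t * h ^ 2 / Real.pi := by positivity
  have key := Complex.tsum_exp_neg_quadratic (a := ((t * h ^ 2 / Real.pi : ℝ) : ℂ)) (by rw [Complex.ofReal_re]; exact ha)
    (Complex.I * ((h * x / (2 * Real.pi) : ℝ) : ℂ))
  have hpc : (Real.pi : ℂ) ≠ 0 := by exact_mod_cast hp.ne'
  have htc : (t : ℂ) ≠ 0 := by exact_mod_cast ht.ne'
  have hhc : (h : ℂ) ≠ 0 := by exact_mod_cast hh.ne'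
  have e0 : ∑' n : ℤ, TH x t h n = ∑' n : ℤ, Complex.exp (-(Real.pi : ℂ) * ((t * h ^ 2 / Real.pi : ℝ) : ℂ) * (n : ℂ) ^ 2 + 2 * (Real.pi : ℂ) * (Complex.I * ((h * x / (2 * Real.pi) : ℝ) : ℂ)) * (n : ℂ)) := by
    congr 1; ext n
    rw [TH]
    congr 1
    push_cast
    field_simp
  rw [e0, key]
  have e2 : (((t * h ^ 2 / Real.pi : ℝ) : ℂ)) ^ (1 / 2 : ℂ) = ((Real.sqrt (t * h ^ 2 / Real.pi) : ℝ) : ℂ) := by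
    rw [Real.sqrt_eq_rpow, Complex.ofReal_cpow ha.le]
    simp
  rw [e2]
  simp only [Function.comp]
  rw [Complex.ofReal_mul, Complex.ofReal_tsum, ← mul_assoc]
  congr 1
  · rw [← Complex.ofReal_one, ← Complex.ofReal_div, ← Complex.ofReal_mul]
    congr 1
    rw [Real.sqrt_div (by positivity), Real.sqrt_div (by positivity), Real.sqrt_mul ht.le, Real.sqrt_sq hh.le]
    have : 0 < Real.sqrt t := Real.sqrt_pos.2 ht
    field_simp
  · congr 1; ext n
    rw [Complex.ofReal_exp]
    congr 1
    have : Complex.I * (Complex.I * ((h * x / (2 * Real.pi) : ℝ) : ℂ)) = -((h * x / (2 * Real.pi) : ℝ) : ℂ) := by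
      rw [← mul_assoc, Complex.I_mul_I]; ring
    rw [this]
    push_cast
    field_simp
    ring

/-- the heat-kernel sum -/
noncomputable def KK (N : ℕ) (ξ : EuclideanSpace ℝ (Fin N)) (h t : ℝ) : ℝ :=
  ∑' k : {k : Fin N → ℤ // k ≠ 0}, (2 - 2 * Real.cos (h * latDot N k.1 ξ)) * Real.exp (-(t * h ^ 2) * qf N k.1)

lemma TH_prod (N : ℕ) (ξ : EuclideanSpace ℝ (Fin N)) (t h : ℝ) (k : Fin N → ℤ) :
    ∏ i, TH (ξ i) t h (k i) = ((Real.exp (-(t * h ^ 2) * qf N k) : ℝ) : ℂ) *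
      Complex.exp (((h * latDot N k ξ : ℝ) : ℂ) * Complex.I) := by
  simp only [TH]
  rw [← Complex.exp_sum, Finset.sum_add_distrib, Complex.exp_add, ← Complex.ofReal_sum, ← Finset.mul_sum,
    ← Finset.sum_mul, ← Complex.ofReal_sum, Complex.ofReal_exp, qf, latDot, Finset.mul_sum]
  congr 5
  rw [Finset.mul_sum]
  apply Finset.sum_congr rfl
  intros; ring

lemma KK_eq (N : ℕ) (ξ : EuclideanSpace ℝ (Fin N)) {t h : ℝ} (ht : 0 < t) (hh : 0 < h) :
    KK N ξ h t = 2 * (∏ _i : Fin N, ∑' n, TH 0 t h n).re - 2 * (∏ i : Fin N, ∑' n, TH (ξ i) t h n).re := by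
  have hs : ∀ x, Summable fun n => ‖TH x t h n‖ := fun x => by
    simp only [TH_norm]; exact summable_gauss1 (by positivity)
  have A := Complex.hasSum_re (hasSum_pi_prod N (fun i => TH (ξ i) t h) (fun i => hs _)).2
  have B := Complex.hasSum_re (hasSum_pi_prod N (fun i => TH 0 t h) (fun i => hs _)).2
  have C := (B.mul_left 2).sub (A.mul_left 2)
  rw [← C.tsum_eq, KK]
  have D : ∀ k : Fin N → ℤ, 2 * (∏ i, TH 0 t h (k i)).re - 2 * (∏ i, TH (ξ i) t h (k i)).re =
      (2 - 2 * Real.cos (h * latDot N k ξ)) * Real.exp (-(t * h ^ 2) * qf N k) := by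
    intro k
    have := TH_prod N 0 t h k
    simp only [PiLp.zero_apply] at this
    rw [TH_prod, this, Complex.re_ofReal_mul, Complex.re_ofReal_mul, Complex.exp_ofReal_mul_I_re,
      Complex.exp_ofReal_mul_I_re]
    have : latDot N k 0 = 0 := by simp [latDot]
    rw [this]
    simp
    ring
  simp only [D]
  refine tsum_subtype_eq_of_support_subset (s := {k : Fin N → ℤ | k ≠ 0}) (f := fun k => (2 - 2 * Real.cos (h * latDot N k ξ)) * Real.exp (-(t * h ^ 2) * qf N k)) ?_
  intro k hk
  rintro rfl
  apply hk
  simp [latDot]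

lemma KK_tendsto (N : ℕ) (ξ : EuclideanSpace ℝ (Fin N)) {t : ℝ} (ht : 0 < t) :
    Tendsto (fun h : ℝ => h ^ N * KK N ξ h t) (𝓝[>] 0)
      (𝓝 (2 * (Real.pi / t) ^ ((N : ℝ) / 2) * (1 - Real.exp (-‖ξ‖ ^ 2 / (4 * t))))) := by
  have hp := Real.pi_pos
  have hprod : ∀ η : EuclideanSpace ℝ (Fin N), Tendsto (fun h : ℝ => h ^ N * (∏ i : Fin N, ∑' n, TH (η i) t h n).re) (𝓝[>] 0)
      (𝓝 ((Real.pi / t) ^ ((N : ℝ) / 2) * Real.exp (-‖η‖ ^ 2 / (4 * t)))) := by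
    intro η
    have h1 := tendsto_finsetProd (Finset.univ : Finset (Fin N)) (fun i _ => TH_tendsto (η i) ht)
    have h2 := (Complex.continuous_re.tendsto _).comp h1
    have e : (∏ i : Fin N, ((Real.sqrt (Real.pi / t) * Real.exp (-η i ^ 2 / (4 * t)) : ℝ) : ℂ)).re =
        (Real.pi / t) ^ ((N : ℝ) / 2) * Real.exp (-‖η‖ ^ 2 / (4 * t)) := by
      rw [← Complex.ofReal_prod, Complex.ofReal_re, Finset.prod_mul_distrib, ← Real.exp_sum, EuclideanSpace.real_norm_sq_eq]
      congr 1
      · rw [Finset.prod_const, Finset.card_univ, Fintype.card_fin, Real.sqrt_eq_rpow,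
          ← Real.rpow_mul_natCast (by positivity)]
        congr 1; ring
      · rw [← Finset.sum_div, Finset.sum_neg_distrib]
    rw [e] at h2
    refine h2.congr fun h => ?_
    simp only [Function.comp]
    rw [Finset.prod_mul_distrib, Finset.prod_const, Finset.card_univ, Fintype.card_fin, ← Complex.ofReal_pow,
      Complex.re_ofReal_mul]
  have h0 := hprod 0
  simp only [PiLp.zero_apply] at h0
  have := (h0.const_mul 2).sub ((hprod ξ).const_mul 2)
  have e : 2 * ((Real.pi / t) ^ ((N : ℝ) / 2) * Real.exp (-‖(0 : EuclideanSpace ℝ (Fin N))‖ ^ 2 / (4 * t))) -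
      2 * ((Real.pi / t) ^ ((N : ℝ) / 2) * Real.exp (-‖ξ‖ ^ 2 / (4 * t))) = 2 * (Real.pi / t) ^ ((N : ℝ) / 2) * (1 - Real.exp (-‖ξ‖ ^ 2 / (4 * t))) := by
    simp; ring
  rw [e] at this
  refine this.congr' ?_
  filter_upwards [self_mem_nhdsWithin] with h hh
  rw [KK_eq N ξ ht hh]
  ring

lemma KK_term_nonneg (N : ℕ) (ξ : EuclideanSpace ℝ (Fin N)) (h t : ℝ) (k : Fin N → ℤ) :
    0 ≤ (2 - 2 * Real.cos (h * latDot N k ξ)) * Real.exp (-(t * h ^ 2) * qf N k) :=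
  mul_nonneg (by linarith [Real.cos_le_one (h * latDot N k ξ)]) (Real.exp_pos _).le

lemma KK_nonneg (N : ℕ) (ξ : EuclideanSpace ℝ (Fin N)) (h t : ℝ) : 0 ≤ KK N ξ h t :=
  tsum_nonneg fun k => KK_term_nonneg N ξ h t k.1

lemma summable_sub (N : ℕ) {s : ℝ} (hs : 0 < s) :
    Summable fun k : {k : Fin N → ℤ // k ≠ 0} => Real.exp (-s * qf N k.1) :=
  (hasSum_gaussN N hs).summable.subtype {k | k ≠ 0}

lemma KK_term_le4 (N : ℕ) (ξ : EuclideanSpace ℝ (Fin N)) (h t : ℝ) (k : Fin N → ℤ) :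
    (2 - 2 * Real.cos (h * latDot N k ξ)) * Real.exp (-(t * h ^ 2) * qf N k) ≤
      4 * Real.exp (-(t * h ^ 2) * qf N k) := by
  apply mul_le_mul_of_nonneg_right _ (Real.exp_pos _).le
  linarith [Real.neg_one_le_cos (h * latDot N k ξ)]

lemma KK_summable (N : ℕ) (ξ : EuclideanSpace ℝ (Fin N)) {h t : ℝ} (hh : 0 < h) (ht : 0 < t) :
    Summable fun k : {k : Fin N → ℤ // k ≠ 0} =>
      (2 - 2 * Real.cos (h * latDot N k.1 ξ)) * Real.exp (-(t * h ^ 2) * qf N k.1) :=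
  Summable.of_nonneg_of_le (fun k => KK_term_nonneg N ξ h t k.1) (fun k => KK_term_le4 N ξ h t k.1)
    ((summable_sub N (by positivity)).mul_left 4)

lemma latDot_sq_le (N : ℕ) (ξ : EuclideanSpace ℝ (Fin N)) (k : Fin N → ℤ) :
    latDot N k ξ ^ 2 ≤ qf N k * ‖ξ‖ ^ 2 := by
  rw [EuclideanSpace.real_norm_sq_eq]
  exact Finset.sum_mul_sq_le_sq_mul_sq _ _ _

lemma KK_term_le2 (N : ℕ) (ξ : EuclideanSpace ℝ (Fin N)) {h t : ℝ} (ht : 0 < t) (k : Fin N → ℤ) :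
    (2 - 2 * Real.cos (h * latDot N k ξ)) * Real.exp (-(t * h ^ 2) * qf N k) ≤
      (‖ξ‖ ^ 2 * (2 * t⁻¹)) * Real.exp (-(t / 2 * h ^ 2) * qf N k) := by
  have h1 : 2 - 2 * Real.cos (h * latDot N k ξ) ≤ h ^ 2 * (qf N k * ‖ξ‖ ^ 2) := by
    have := Real.one_sub_sq_div_two_le_cos (x := h * latDot N k ξ)
    have h2 := mul_le_mul_of_nonneg_left (latDot_sq_le N ξ k) (sq_nonneg h)
    rw [mul_pow] at this
    linarith
  have e : Real.exp (-(t * h ^ 2) * qf N k) = Real.exp (-(t / 2 * h ^ 2) * qf N k) * Real.exp (-(t / 2 * h ^ 2 * qf N k)) := by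
    rw [← Real.exp_add]; congr 1; ring
  have h3 : (t / 2 * h ^ 2 * qf N k) * Real.exp (-(t / 2 * h ^ 2 * qf N k)) ≤ 1 := by
    rw [Real.exp_neg, ← div_eq_mul_inv, div_le_one (Real.exp_pos _)]
    linarith [Real.add_one_le_exp (t / 2 * h ^ 2 * qf N k)]
  calc _ ≤ (h ^ 2 * (qf N k * ‖ξ‖ ^ 2)) * Real.exp (-(t * h ^ 2) * qf N k) :=
        mul_le_mul_of_nonneg_right h1 (Real.exp_pos _).le
    _ = (‖ξ‖ ^ 2 * (2 * t⁻¹)) * Real.exp (-(t / 2 * h ^ 2) * qf N k) *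
        ((t / 2 * h ^ 2 * qf N k) * Real.exp (-(t / 2 * h ^ 2 * qf N k))) := by
        rw [e]; field_simp
    _ ≤ _ := by
        apply mul_le_of_le_one_right _ h3
        have := Real.exp_pos (-(t / 2 * h ^ 2) * qf N k)
        positivity

lemma pow_aux (N : ℕ) {h t : ℝ} (hh : 0 < h) (ht : 0 < t) :
    h ^ N * (t * h ^ 2) ^ (-(N : ℝ) / 2) = t ^ (-(N : ℝ) / 2) := by
  rw [Real.mul_rpow ht.le (by positivity), ← Real.rpow_natCast h 2, ← Real.rpow_mul hh.le, ← Real.rpow_natCast h N,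
    mul_left_comm, ← Real.rpow_add hh]
  have : (N : ℝ) + ((2 : ℕ) : ℝ) * (-(N : ℝ) / 2) = 0 := by push_cast; ring
  rw [this]; simp

lemma tsum_le_aux {ι : Type} {f g : ι → ℝ} {c A : ℝ} (hc : 0 ≤ c) (hf : Summable f) (hg : Summable g)
    (h : ∀ i, f i ≤ c * g i) (hA : ∑' i, g i ≤ A) : ∑' i, f i ≤ c * A := by
  refine (hf.tsum_le_tsum h (hg.mul_left c)).trans ?_
  rw [tsum_mul_left]
  exact mul_le_mul_of_nonneg_left hA hc

lemma KK_bound (N : ℕ) (ξ : EuclideanSpace ℝ (Fin N)) : ∃ M : ℝ, 0 ≤ M ∧ ∀ h t : ℝ, 0 < h → 0 < t →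
    h ^ N * KK N ξ h t ≤ M * (t ^ (-(N : ℝ) / 2) * min 1 t⁻¹) := by
  obtain ⟨C, hC, hb⟩ := gaussN_bound N
  set D := C * (1 / 2 : ℝ) ^ (-(N : ℝ) / 2) with hD
  have hD0 : 0 ≤ D := by positivity
  refine ⟨4 * C + 2 * ‖ξ‖ ^ 2 * D, by positivity, ?_⟩
  intro h t hh ht
  have htp : 0 < t ^ (-(N : ℝ) / 2) := by positivity
  have hti : 0 < t⁻¹ := by positivity
  have A : h ^ N * KK N ξ h t ≤ (4 * C) * t ^ (-(N : ℝ) / 2) := by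
    have h1 : KK N ξ h t ≤ 4 * (C * (t * h ^ 2) ^ (-(N : ℝ) / 2)) := by
      have hs : 0 < t * h ^ 2 := by positivity
      exact tsum_le_aux (by norm_num) (KK_summable N ξ hh ht) (summable_sub N hs)
        (fun k => KK_term_le4 N ξ h t k.1) (hb _ hs)
    calc _ ≤ h ^ N * (4 * (C * (t * h ^ 2) ^ (-(N : ℝ) / 2))) := by gcongr
      _ = (4 * C) * (h ^ N * (t * h ^ 2) ^ (-(N : ℝ) / 2)) := by ring
      _ = _ := by rw [pow_aux N hh ht]
  have B : h ^ N * KK N ξ h t ≤ (2 * ‖ξ‖ ^ 2 * D) * (t ^ (-(N : ℝ) / 2) * t⁻¹) := by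
    have h1 : KK N ξ h t ≤ (‖ξ‖ ^ 2 * (2 * t⁻¹)) * (C * (t / 2 * h ^ 2) ^ (-(N : ℝ) / 2)) := by
      have hs : 0 < t / 2 * h ^ 2 := by positivity
      exact tsum_le_aux (by positivity) (KK_summable N ξ hh ht) (summable_sub N hs)
        (fun k => KK_term_le2 N ξ ht k.1) (hb _ hs)
    calc _ ≤ h ^ N * ((‖ξ‖ ^ 2 * (2 * t⁻¹)) * (C * (t / 2 * h ^ 2) ^ (-(N : ℝ) / 2))) := by gcongr
      _ = (‖ξ‖ ^ 2 * (2 * t⁻¹)) * C * (h ^ N * (t / 2 * h ^ 2) ^ (-(N : ℝ) / 2)) := by ring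
      _ = (‖ξ‖ ^ 2 * (2 * t⁻¹)) * C * (t * (1 / 2)) ^ (-(N : ℝ) / 2) := by
          rw [pow_aux N hh (by positivity)]; congr 2; ring
      _ = _ := by rw [Real.mul_rpow ht.le (by norm_num), hD]; ring
  have P1 : 0 ≤ 4 * C * (t ^ (-(N : ℝ) / 2) * t⁻¹) := by positivity
  have P2 : 0 ≤ (2 * ‖ξ‖ ^ 2 * D) * t ^ (-(N : ℝ) / 2) := by positivity
  rcases min_cases 1 t⁻¹ with ⟨e, _⟩ | ⟨e, _⟩
  · rw [e]; linarith
  · rw [e]; linarith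

lemma kern_int {β : ℝ} (h0 : 0 < β) (h1 : β < 1) :
    IntegrableOn (fun t : ℝ => t ^ (β - 1) * min 1 t⁻¹) (Set.Ioi 0) ∧
      ∫ t in Set.Ioi (0 : ℝ), t ^ (β - 1) * min 1 t⁻¹ = 1 / β + 1 / (1 - β) := by
  have hu : Set.Ioi (0 : ℝ) = Set.Ioc 0 1 ∪ Set.Ioi 1 := (Set.Ioc_union_Ioi_eq_Ioi zero_le_one).symm
  have e1 : Set.EqOn (fun t : ℝ => t ^ (β - 1)) (fun t : ℝ => t ^ (β - 1) * min 1 t⁻¹) (Set.Ioc 0 1) := by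
    intro t ht
    have : 1 ≤ t⁻¹ := (one_le_inv₀ ht.1).2 ht.2
    simp [min_eq_left this]
  have e2 : Set.EqOn (fun t : ℝ => t ^ (β - 2)) (fun t : ℝ => t ^ (β - 1) * min 1 t⁻¹) (Set.Ioi 1) := by
    intro t ht
    have ht : 1 < t := ht
    have : t⁻¹ ≤ 1 := inv_le_one_of_one_le₀ ht.le
    simp only [min_eq_right this]
    rw [← Real.rpow_neg_one t, ← Real.rpow_add (by linarith)]
    congr 1; ring
  have i1 : IntegrableOn (fun t : ℝ => t ^ (β - 1)) (Set.Ioc 0 1) := by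
    rw [← intervalIntegrable_iff_integrableOn_Ioc_of_le zero_le_one]
    exact intervalIntegral.intervalIntegrable_rpow' (by linarith)
  have i2 : IntegrableOn (fun t : ℝ => t ^ (β - 2)) (Set.Ioi 1) :=
    integrableOn_Ioi_rpow_of_lt (by linarith) one_pos
  have j1 := i1.congr_fun e1 measurableSet_Ioc
  have j2 := i2.congr_fun e2 measurableSet_Ioi
  refine ⟨by rw [hu]; exact j1.union j2, ?_⟩
  rw [hu, setIntegral_union (Set.Ioc_disjoint_Ioi le_rfl) measurableSet_Ioi j1 j2,
    ← setIntegral_congr_fun measurableSet_Ioc e1, ← setIntegral_congr_fun measurableSet_Ioi e2,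
    ← intervalIntegral.integral_of_le zero_le_one, integral_rpow (Or.inl (by linarith)),
    integral_Ioi_rpow_of_lt (by linarith) one_pos]
  simp only [Real.one_rpow]
  rw [Real.zero_rpow (by linarith)]
  have : (1 - β) ≠ 0 := by linarith
  have h2 : β - 2 + 1 = -(1 - β) := by ring
  rw [h2, neg_div_neg_eq]
  simp

lemma gamma_int {β c : ℝ} (h0 : 0 < β) (h1 : β < 1) (hc : 0 ≤ c) :
    ∫ t in Set.Ioi (0 : ℝ), t ^ (β - 1) * (1 - Real.exp (-c / t)) = c ^ β * Real.Gamma (1 - β) / β := by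
  rcases hc.eq_or_lt with rfl | hc
  · simp [Real.zero_rpow h0.ne']
  have hΓ := Real.Gamma_pos_of_pos (show 0 < 1 - β by linarith)
  have I1 : ∫ t in Set.Ioi (0 : ℝ), t ^ (β - 2) * Real.exp (-c / t) = c ^ (β - 1) * Real.Gamma (1 - β) := by
    rw [← integral_comp_rpow_Ioi _ (show (-1 : ℝ) ≠ 0 by norm_num)]
    have := Real.integral_rpow_mul_exp_neg_mul_Ioi (show 0 < 1 - β by linarith) hc
    rw [one_div, Real.inv_rpow hc.le, ← Real.rpow_neg hc.le, neg_sub] at this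
    rw [← this]
    apply setIntegral_congr_fun measurableSet_Ioi
    intro x hx
    have hx : 0 < x := hx
    simp only [smul_eq_mul, abs_neg, abs_one, one_mul]
    rw [← Real.rpow_mul hx.le, ← mul_assoc, ← Real.rpow_add hx, Real.rpow_neg_one]
    congr 2
    · ring
    · field_simp
  have J1 : IntegrableOn (fun t : ℝ => t ^ (β - 2) * Real.exp (-c / t)) (Set.Ioi 0) := by
    by_contra hn
    have := integral_undef hn
    rw [I1] at this
    have : 0 < c ^ (β - 1) * Real.Gamma (1 - β) := by positivity
    linarith
  have hub : ∀ t : ℝ, 0 < t → 0 ≤ 1 - Real.exp (-c / t) ∧ 1 - Real.exp (-c / t) ≤ 1 ∧ 1 - Real.exp (-c / t) ≤ c * t⁻¹ := by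
    intro t ht
    have h2 : 0 ≤ c / t := by positivity
    refine ⟨?_, ?_, ?_⟩
    · have : Real.exp (-c / t) ≤ 1 := by rw [Real.exp_le_one_iff, neg_div]; linarith
      linarith
    · linarith [Real.exp_pos (-c / t)]
    · have := Real.add_one_le_exp (-c / t)
      rw [← div_eq_mul_inv]
      rw [neg_div] at this ⊢
      linarith
  have hmeas : Measurable fun t : ℝ => t ^ (β - 1) * (1 - Real.exp (-c / t)) := by fun_prop
  have J2 : IntegrableOn (fun t : ℝ => t ^ (β - 1) * (1 - Real.exp (-c / t))) (Set.Ioi 0) := by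
    refine Integrable.mono' ((kern_int h0 h1).1.const_mul (1 + c)) hmeas.aestronglyMeasurable ?_
    refine (ae_restrict_iff' measurableSet_Ioi).2 (Eventually.of_forall fun t ht => ?_)
    have ht : 0 < t := ht
    obtain ⟨a1, a2, a3⟩ := hub t ht
    have hp : 0 < t ^ (β - 1) := by positivity
    rw [Real.norm_of_nonneg (by positivity)]
    have hti : 0 < t⁻¹ := by positivity
    have : 1 - Real.exp (-c / t) ≤ (1 + c) * min 1 t⁻¹ := by
      rcases min_cases 1 t⁻¹ with ⟨e, _⟩ | ⟨e, _⟩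
      · rw [e]; linarith
      · rw [e]; linarith
    calc _ ≤ t ^ (β - 1) * ((1 + c) * min 1 t⁻¹) := by gcongr
      _ = _ := by ring
  have key := integral_Ioi_mul_deriv_eq_deriv_mul (a := 0) (a' := 0) (b' := 0)
    (u := fun t : ℝ => 1 - Real.exp (-c / t)) (v := fun t : ℝ => t ^ β / β)
    (u' := fun t : ℝ => -(c * t ^ (-2 : ℝ) * Real.exp (-c / t))) (v' := fun t : ℝ => t ^ (β - 1)) ?_ ?_ ?_ ?_ ?_ ?_
  · have e1 : ∫ t in Set.Ioi (0 : ℝ), t ^ (β - 1) * (1 - Real.exp (-c / t)) =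
        ∫ t in Set.Ioi (0 : ℝ), (1 - Real.exp (-c / t)) * t ^ (β - 1) := by
      congr 1; ext t; ring
    have e2 : ∫ t in Set.Ioi (0 : ℝ), -(c * t ^ (-2 : ℝ) * Real.exp (-c / t)) * (t ^ β / β) =
        ∫ t in Set.Ioi (0 : ℝ), (-c / β) * (t ^ (β - 2) * Real.exp (-c / t)) := by
      apply setIntegral_congr_fun measurableSet_Ioi
      intro x hx
      have hx : 0 < x := hx
      have : x ^ (β - 2) = x ^ (-2 : ℝ) * x ^ β := by rw [← Real.rpow_add hx]; congr 1; ring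
      simp only [this]
      ring
    rw [e1, key, e2, integral_const_mul, I1]
    have : c ^ β = c * c ^ (β - 1) := by
      rw [Real.rpow_sub_one hc.ne']; field_simp
    rw [this]; ring
  · intro t ht
    have ht : 0 < t := ht
    have h2 := (((hasDerivAt_inv ht.ne').const_mul (-c)).exp).const_sub 1
    simp only [div_eq_mul_inv]
    have e : -(c * t ^ (-2 : ℝ) * Real.exp (-c * t⁻¹)) = -(Real.exp (-c * t⁻¹) * (-c * -(t ^ 2)⁻¹)) := by
      rw [Real.rpow_neg ht.le]
      norm_cast
      ring
    rw [e]
    exact h2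
  · intro t ht
    have ht : 0 < t := ht
    have := (Real.hasDerivAt_rpow_const (x := t) (p := β) (Or.inl ht.ne')).div_const β
    have e : t ^ (β - 1) = β * t ^ (β - 1) / β := by field_simp
    rw [e]
    exact this
  · refine J2.congr_fun ?_ measurableSet_Ioi
    intro t _
    simp only [Pi.mul_apply]; ring
  · refine IntegrableOn.congr_fun (f := fun t : ℝ => (-c / β) * (t ^ (β - 2) * Real.exp (-c / t))) (J1.const_mul (-c / β)) ?_ measurableSet_Ioi
    intro x hx
    have hx : 0 < x := hx
    have : x ^ (β - 2) = x ^ (-2 : ℝ) * x ^ β := by rw [← Real.rpow_add hx]; congr 1; ring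
    simp only [this, Pi.mul_apply]
    ring
  · have hlim : Tendsto (fun t : ℝ => t ^ β / β) (𝓝[>] 0) (𝓝 0) := by
      have : Tendsto (fun t : ℝ => t ^ β / β) (𝓝 0) (𝓝 (0 ^ β / β)) :=
        ((Real.continuousAt_rpow_const 0 β (Or.inr h0.le)).div_const β)
      rw [Real.zero_rpow h0.ne', zero_div] at this
      exact this.mono_left nhdsWithin_le_nhds
    refine squeeze_zero' ?_ ?_ hlim
    · filter_upwards [self_mem_nhdsWithin] with t ht
      have ht : 0 < t := ht
      have := (hub t ht).1
      simp only [Pi.mul_apply]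
      positivity
    · filter_upwards [self_mem_nhdsWithin] with t ht
      have ht : 0 < t := ht
      simp only [Pi.mul_apply]
      exact mul_le_of_le_one_left (by positivity) (hub t ht).2.1
  · have hlim : Tendsto (fun t : ℝ => (c / β) * t ^ (-(1 - β))) atTop (𝓝 0) := by
      have := (tendsto_rpow_neg_atTop (show 0 < 1 - β by linarith)).const_mul (c / β)
      simpa using this
    refine squeeze_zero' ?_ ?_ hlim
    · filter_upwards [eventually_gt_atTop 0] with t ht
      have := (hub t ht).1
      simp only [Pi.mul_apply]
      positivity
    · filter_upwards [eventually_gt_atTop 0] with t ht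
      simp only [Pi.mul_apply]
      have : t ^ (-(1 - β)) = t⁻¹ * t ^ β := by
        rw [← Real.rpow_neg_one t, ← Real.rpow_add ht]; congr 1; ring
      rw [this]
      calc _ ≤ c * t⁻¹ * (t ^ β / β) := mul_le_mul_of_nonneg_right (hub t ht).2.2 (by positivity)
        _ = _ := by ring

/-- lattice sum -/
noncomputable def Sig (N : ℕ) (ξ : EuclideanSpace ℝ (Fin N)) (h α : ℝ) : ℝ :=
  ∑' k : {k : Fin N → ℤ // k ≠ 0},
    (2 * Real.cos (h * latDot N k.1 ξ) - 2) / latNorm N k.1 ^ ((N : ℝ) + α)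

lemma dom_bound (N : ℕ) (ξ : EuclideanSpace ℝ (Fin N)) {M α : ℝ}
    (hM : ∀ h t : ℝ, 0 < h → 0 < t → h ^ N * KK N ξ h t ≤ M * (t ^ (-(N : ℝ) / 2) * min 1 t⁻¹))
    {h t : ℝ} (hh : 0 < h) (ht : 0 < t) :
    t ^ (((N : ℝ) + α) / 2 - 1) * (h ^ N * KK N ξ h t) ≤ M * (t ^ (α / 2 - 1) * min 1 t⁻¹) := by
  have h1 := mul_le_mul_of_nonneg_left (hM h t hh ht) (Real.rpow_nonneg ht.le (((N : ℝ) + α) / 2 - 1))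
  refine h1.trans (le_of_eq ?_)
  have : t ^ (α / 2 - 1) = t ^ (((N : ℝ) + α) / 2 - 1) * t ^ (-(N : ℝ) / 2) := by
    rw [← Real.rpow_add ht]; congr 1; ring
  rw [this]; ring

lemma KK_measurable (N : ℕ) (ξ : EuclideanSpace ℝ (Fin N)) (h : ℝ) : Measurable (KK N ξ h) := by
  unfold KK
  refine measurable_tsum_nonneg
    (fun (k : {k : Fin N → ℤ // k ≠ 0}) t =>
      (2 - 2 * Real.cos (h * latDot N k.1 ξ)) * Real.exp (-(t * h ^ 2) * qf N k.1))
    (fun k t => KK_term_nonneg N ξ h t k.1) (fun k => ?_)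
  fun_prop

lemma term_int (N : ℕ) (ξ : EuclideanSpace ℝ (Fin N)) {h α : ℝ} (hh : 0 < h) (h0 : 0 < α) (k : Fin N → ℤ) (hk : k ≠ 0) :
    ∫ t in Set.Ioi (0 : ℝ), t ^ (((N : ℝ) + α) / 2 - 1) *
      (h ^ N * ((2 - 2 * Real.cos (h * latDot N k ξ)) * Real.exp (-(t * h ^ 2) * qf N k))) =
    -Real.Gamma (((N : ℝ) + α) / 2) * h ^ (-α) *
      ((2 * Real.cos (h * latDot N k ξ) - 2) / latNorm N k ^ ((N : ℝ) + α)) := by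
  have hq : 0 < qf N k := by linarith [one_le_qf N k hk]
  have hN : (0 : ℝ) ≤ N := by positivity
  have ha : 0 < ((N : ℝ) + α) / 2 := by linarith
  have e1 : ∀ t : ℝ, t ^ (((N : ℝ) + α) / 2 - 1) *
      (h ^ N * ((2 - 2 * Real.cos (h * latDot N k ξ)) * Real.exp (-(t * h ^ 2) * qf N k))) =
      (h ^ N * (2 - 2 * Real.cos (h * latDot N k ξ))) *
        (t ^ (((N : ℝ) + α) / 2 - 1) * Real.exp (-((h ^ 2 * qf N k) * t))) := by
    intro t
    have : -(t * h ^ 2) * qf N k = -((h ^ 2 * qf N k) * t) := by ring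
    rw [this]; ring
  simp only [e1]
  rw [integral_const_mul, Real.integral_rpow_mul_exp_neg_mul_Ioi ha (by positivity)]
  have e2 : latNorm N k ^ ((N : ℝ) + α) = qf N k ^ (((N : ℝ) + α) / 2) := by
    rw [latNorm, ← qf, Real.sqrt_eq_rpow, ← Real.rpow_mul hq.le]; congr 1; ring
  have e3 : (1 / (h ^ 2 * qf N k)) ^ (((N : ℝ) + α) / 2) = h ^ (-(N : ℝ)) * h ^ (-α) / qf N k ^ (((N : ℝ) + α) / 2) := by
    rw [Real.div_rpow zero_le_one (by positivity), Real.one_rpow, Real.mul_rpow (by positivity) hq.le,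
      ← Real.rpow_natCast h 2, ← Real.rpow_mul hh.le, ← Real.rpow_add hh]
    have : ((2 : ℕ) : ℝ) * (((N : ℝ) + α) / 2) = N + α := by push_cast; ring
    rw [this, one_div, mul_inv, ← Real.rpow_neg hh.le, div_eq_mul_inv]
    congr 2; ring
  rw [e2, e3, Real.rpow_neg hh.le, Real.rpow_natCast]
  have : 0 < qf N k ^ (((N : ℝ) + α) / 2) := by positivity
  field_simp
  ring

lemma sig_repr (N : ℕ) (ξ : EuclideanSpace ℝ (Fin N)) {h α : ℝ} (hh : 0 < h) (h0 : 0 < α) (h2 : α < 2) :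
    ∫ t in Set.Ioi (0 : ℝ), t ^ (((N : ℝ) + α) / 2 - 1) * (h ^ N * KK N ξ h t) =
      -Real.Gamma (((N : ℝ) + α) / 2) * h ^ (-α) * Sig N ξ h α := by
  obtain ⟨M, hM0, hM⟩ := KK_bound N ξ
  let f : {k : Fin N → ℤ // k ≠ 0} → ℝ → ℝ := fun k t => t ^ (((N : ℝ) + α) / 2 - 1) *
      (h ^ N * ((2 - 2 * Real.cos (h * latDot N k.1 ξ)) * Real.exp (-(t * h ^ 2) * qf N k.1)))
  have hfm : ∀ k, Measurable (f k) := fun k => by simp only [f]; fun_prop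
  have hf0 : ∀ k, ∀ t : ℝ, 0 < t → 0 ≤ f k t := fun k t ht => by
    have := KK_term_nonneg N ξ h t k.1
    simp only [f]; positivity
  have hfs : ∀ t : ℝ, 0 < t → Summable fun k => f k t := fun t ht =>
    ((KK_summable N ξ hh ht).mul_left _).mul_left _
  have hft : ∀ t : ℝ, ∑' k, f k t = t ^ (((N : ℝ) + α) / 2 - 1) * (h ^ N * KK N ξ h t) := fun t => by
    simp only [f]
    rw [tsum_mul_left, tsum_mul_left, KK]
  have hk := (kern_int (show 0 < α / 2 by linarith) (show α / 2 < 1 by linarith)).1.const_mul M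
  have fin : ∑' k, ∫⁻ t in Set.Ioi (0 : ℝ), ‖f k t‖ₑ ≠ ⊤ := by
    rw [← lintegral_tsum (fun k => (hfm k).enorm.aemeasurable)]
    refine ne_of_lt (lt_of_le_of_lt ?_ hk.lintegral_lt_top)
    refine setLIntegral_mono' measurableSet_Ioi fun t ht => ?_
    have ht : 0 < t := ht
    have : ∑' k, ‖f k t‖ₑ = ENNReal.ofReal (∑' k, f k t) := by
      rw [ENNReal.ofReal_tsum_of_nonneg (fun k => hf0 k t ht) (hfs t ht)]
      congr 1; ext k
      rw [Real.enorm_of_nonneg (hf0 k t ht)]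
    rw [this, hft]
    exact ENNReal.ofReal_le_ofReal (dom_bound N ξ hM hh ht)
  have key := integral_tsum (fun k => (hfm k).aestronglyMeasurable) fin
  simp only [hft] at key
  rw [key, Sig, ← tsum_mul_left]
  congr 1; ext k
  exact term_int N ξ hh h0 k.1 k.2

noncomputable def cc (N : ℕ) (α : ℝ) : ℝ := α * Real.Gamma (α / 2) * Real.sin (α * Real.pi / 2) /
    (2 ^ ((2 : ℝ) - α) * Real.pi ^ (1 + (N : ℝ) / 2))

lemma G_eq (N : ℕ) (ξ : EuclideanSpace ℝ (Fin N)) {h α : ℝ} (hh : 0 < h) (h0 : 0 < α) (h2 : α < 2) :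
    bConst N α * h ^ (-α) * Sig N ξ h α =
      -cc N α * ∫ t in Set.Ioi (0 : ℝ), t ^ (((N : ℝ) + α) / 2 - 1) * (h ^ N * KK N ξ h t) := by
  rw [sig_repr N ξ hh h0 h2, bConst, cc]
  ring

lemma cc_eq (N : ℕ) {α : ℝ} (h0 : 0 < α) (h2 : α < 2) {r : ℝ} (hr : 0 ≤ r) :
    cc N α * (2 * Real.pi ^ ((N : ℝ) / 2) * ((r ^ 2 / 4) ^ (α / 2) * Real.Gamma (1 - α / 2) / (α / 2))) = r ^ α := by
  have hp := Real.pi_pos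
  have hs : 0 < Real.sin (Real.pi * (α / 2)) := Real.sin_pos_of_pos_of_lt_pi (by positivity) (by nlinarith)
  have hG := Real.Gamma_mul_Gamma_one_sub (α / 2)
  rw [eq_div_iff hs.ne'] at hG
  have e1 : (r ^ 2 / 4) ^ (α / 2) = r ^ α / 2 ^ α := by
    have : r ^ 2 / 4 = (r / 2) ^ (2 : ℝ) := by
      rw [show (2 : ℝ) = ((2 : ℕ) : ℝ) by norm_num, Real.rpow_natCast]; push_cast; ring
    rw [this, ← Real.rpow_mul (by positivity), Real.div_rpow hr (by norm_num)]
    congr 2 <;> ring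
  have e2 : (2 : ℝ) ^ ((2 : ℝ) - α) = 4 / 2 ^ α := by
    rw [Real.rpow_sub (by norm_num)]; norm_num
  have e3 : Real.pi ^ (1 + (N : ℝ) / 2) = Real.pi * Real.pi ^ ((N : ℝ) / 2) := by
    rw [Real.rpow_add hp, Real.rpow_one]
  have e4 : α * Real.pi / 2 = Real.pi * (α / 2) := by ring
  rw [cc, e1, e2, e3, e4]
  have p1 : 0 < (2 : ℝ) ^ α := by positivity
  have p2 : 0 < Real.pi ^ ((N : ℝ) / 2) := by positivity
  have : α * Real.Gamma (α / 2) * Real.sin (Real.pi * (α / 2)) / (4 / 2 ^ α * (Real.pi * Real.pi ^ ((N : ℝ) / 2))) *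
      (2 * Real.pi ^ ((N : ℝ) / 2) * (r ^ α / 2 ^ α * Real.Gamma (1 - α / 2) / (α / 2))) =
      (Real.Gamma (α / 2) * Real.Gamma (1 - α / 2) * Real.sin (Real.pi * (α / 2))) / Real.pi * r ^ α := by
    generalize Real.Gamma (α / 2) = A
    generalize Real.Gamma (1 - α / 2) = B
    generalize Real.sin (Real.pi * (α / 2)) = C
    field_simp
    ring
  rw [this, hG]
  field_simp

lemma G_tendsto (N : ℕ) (ξ : EuclideanSpace ℝ (Fin N)) {α : ℝ} (h0 : 0 < α) (h2 : α < 2) :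
    Tendsto (fun h : ℝ => bConst N α * h ^ (-α) * Sig N ξ h α) (𝓝[>] 0) (𝓝 (-‖ξ‖ ^ α)) := by
  have hp := Real.pi_pos
  obtain ⟨M, hM0, hM⟩ := KK_bound N ξ
  have hk := (kern_int (show 0 < α / 2 by linarith) (show α / 2 < 1 by linarith)).1.const_mul M
  have lim : Tendsto (fun h : ℝ => ∫ t in Set.Ioi (0 : ℝ), t ^ (((N : ℝ) + α) / 2 - 1) * (h ^ N * KK N ξ h t)) (𝓝[>] 0)
      (𝓝 (∫ t in Set.Ioi (0 : ℝ), t ^ (((N : ℝ) + α) / 2 - 1) *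
        (2 * (Real.pi / t) ^ ((N : ℝ) / 2) * (1 - Real.exp (-‖ξ‖ ^ 2 / (4 * t)))))) := by
    refine tendsto_integral_filter_of_dominated_convergence _ ?_ ?_ hk ?_
    · refine Eventually.of_forall fun h => Measurable.aestronglyMeasurable ?_
      have := KK_measurable N ξ h
      fun_prop
    · filter_upwards [self_mem_nhdsWithin] with h hh
      have hh : 0 < h := hh
      refine (ae_restrict_iff' measurableSet_Ioi).2 (Eventually.of_forall fun t ht => ?_)
      have ht : 0 < t := ht
      have := KK_nonneg N ξ h t
      rw [Real.norm_of_nonneg (by positivity)]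
      exact dom_bound N ξ hM hh ht
    · refine (ae_restrict_iff' measurableSet_Ioi).2 (Eventually.of_forall fun t ht => ?_)
      exact (KK_tendsto N ξ ht).const_mul _
  have val : ∫ t in Set.Ioi (0 : ℝ), t ^ (((N : ℝ) + α) / 2 - 1) *
        (2 * (Real.pi / t) ^ ((N : ℝ) / 2) * (1 - Real.exp (-‖ξ‖ ^ 2 / (4 * t)))) =
      2 * Real.pi ^ ((N : ℝ) / 2) * ((‖ξ‖ ^ 2 / 4) ^ (α / 2) * Real.Gamma (1 - α / 2) / (α / 2)) := by
    rw [← gamma_int (show 0 < α / 2 by linarith) (show α / 2 < 1 by linarith) (by positivity : 0 ≤ ‖ξ‖ ^ 2 / 4),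
      ← integral_const_mul]
    apply setIntegral_congr_fun measurableSet_Ioi
    intro t ht
    have ht : 0 < t := ht
    simp only
    have e1 : -‖ξ‖ ^ 2 / (4 * t) = -(‖ξ‖ ^ 2 / 4) / t := by field_simp
    have e2 : t ^ (((N : ℝ) + α) / 2 - 1) = t ^ (α / 2 - 1) * t ^ ((N : ℝ) / 2) := by
      rw [← Real.rpow_add ht]; congr 1; ring
    have p : 0 < t ^ ((N : ℝ) / 2) := by positivity
    rw [e1, e2, Real.div_rpow hp.le ht.le]
    generalize Real.exp (-(‖ξ‖ ^ 2 / 4) / t) = E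
    field_simp
  rw [val] at lim
  have := lim.const_mul (-cc N α)
  rw [neg_mul, cc_eq N h0 h2 (norm_nonneg ξ)] at this
  refine this.congr' ?_
  filter_upwards [self_mem_nhdsWithin] with h hh
  exact (G_eq N ξ hh h0 h2).symm

lemma cc_bound (N : ℕ) {α : ℝ} (h0 : 0 < α) (h2 : α < 2) :
    0 ≤ cc N α ∧ cc N α * (1 / (α / 2) + 1 / (1 - α / 2)) ≤ 4 * Real.pi := by
  have hp := Real.pi_pos
  obtain ⟨β, hβ⟩ : ∃ β, α = 2 * β := ⟨α / 2, by ring⟩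
  subst hβ
  have b0 : 0 < β := by linarith
  have b1 : 0 < 1 - β := by linarith
  have e4 : 2 * β * Real.pi / 2 = Real.pi * β := by ring
  have e5 : 2 * β / 2 = β := by ring
  have hs : 0 < Real.sin (Real.pi * β) := Real.sin_pos_of_pos_of_lt_pi (by positivity) (by nlinarith)
  have hsb : Real.sin (Real.pi * β) ≤ 2 * Real.pi * (β * (1 - β)) := by
    have s1 := Real.sin_le (show 0 ≤ Real.pi * β by positivity)
    have s2 := Real.sin_le (show 0 ≤ Real.pi * (1 - β) by positivity)
    rw [show Real.pi * (1 - β) = Real.pi - Real.pi * β by ring, Real.sin_pi_sub] at s2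
    rcases le_total β (1 / 2) with hb | hb
    · have : β ≤ 2 * (β * (1 - β)) := by nlinarith
      nlinarith
    · have : 1 - β ≤ 2 * (β * (1 - β)) := by nlinarith
      nlinarith
  have hΓ0 : 0 < Real.Gamma β := Real.Gamma_pos_of_pos b0
  have hΓ : β * Real.Gamma β ≤ 1 := by
    rw [← Real.Gamma_add_one b0.ne']
    have := Real.convexOn_Gamma.2 (show (2 : ℝ) ∈ Set.Ioi 0 by simp) (show (1 : ℝ) ∈ Set.Ioi 0 by simp)
      b0.le b1.le (by ring)
    simp only [smul_eq_mul, Real.Gamma_two, Real.Gamma_one] at this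
    have e : β * 2 + (1 - β) * 1 = β + 1 := by ring
    rw [e] at this
    linarith
  have d1 : 1 ≤ (2 : ℝ) ^ ((2 : ℝ) - 2 * β) := Real.one_le_rpow (by norm_num) (by linarith)
  have d2 : 1 ≤ Real.pi ^ (1 + (N : ℝ) / 2) := Real.one_le_rpow (by linarith [Real.pi_gt_three]) (by positivity)
  have d3 : 1 ≤ (2 : ℝ) ^ ((2 : ℝ) - 2 * β) * Real.pi ^ (1 + (N : ℝ) / 2) := by nlinarith
  have hcc : cc N (2 * β) = 2 * (β * Real.Gamma β) * Real.sin (Real.pi * β) /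
      ((2 : ℝ) ^ ((2 : ℝ) - 2 * β) * Real.pi ^ (1 + (N : ℝ) / 2)) := by
    rw [cc, e4, e5]; ring
  have hnum : 0 ≤ 2 * (β * Real.Gamma β) * Real.sin (Real.pi * β) := by positivity
  have hle : cc N (2 * β) ≤ 4 * Real.pi * (β * (1 - β)) := by
    rw [hcc]
    calc _ ≤ 2 * (β * Real.Gamma β) * Real.sin (Real.pi * β) := div_le_self hnum d3
      _ ≤ 2 * 1 * (2 * Real.pi * (β * (1 - β))) := by gcongr
      _ = _ := by ring
  refine ⟨by rw [hcc]; positivity, ?_⟩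
  have e6 : 1 / β + 1 / (1 - β) = 1 / (β * (1 - β)) := by field_simp; ring
  rw [e5, e6, mul_one_div, div_le_iff₀ (by positivity)]
  exact hle

lemma G_bound (N : ℕ) (ξ : EuclideanSpace ℝ (Fin N)) : ∃ B : ℝ, ∀ h α : ℝ, 0 < h → 0 < α → α < 2 →
    |bConst N α * h ^ (-α) * Sig N ξ h α| ≤ B := by
  obtain ⟨M, hM0, hM⟩ := KK_bound N ξ
  refine ⟨4 * Real.pi * M, fun h α hh h0 h2 => ?_⟩
  obtain ⟨k1, k2⟩ := kern_int (show 0 < α / 2 by linarith) (show α / 2 < 1 by linarith)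
  obtain ⟨c0, c1⟩ := cc_bound N h0 h2
  have I0 : 0 ≤ ∫ t in Set.Ioi (0 : ℝ), t ^ (((N : ℝ) + α) / 2 - 1) * (h ^ N * KK N ξ h t) := by
    refine setIntegral_nonneg measurableSet_Ioi fun t ht => ?_
    have ht : 0 < t := ht
    have := KK_nonneg N ξ h t
    positivity
  have I1 : ∫ t in Set.Ioi (0 : ℝ), t ^ (((N : ℝ) + α) / 2 - 1) * (h ^ N * KK N ξ h t) ≤
      M * (1 / (α / 2) + 1 / (1 - α / 2)) := by
    rw [← k2, ← integral_const_mul]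
    refine integral_mono_of_nonneg ?_ (k1.const_mul M) ?_
    · refine (ae_restrict_iff' measurableSet_Ioi).2 (Eventually.of_forall fun t ht => ?_)
      have ht : 0 < t := ht
      have := KK_nonneg N ξ h t
      simp only [Pi.zero_apply]
      positivity
    · refine (ae_restrict_iff' measurableSet_Ioi).2 (Eventually.of_forall fun t ht => ?_)
      exact dom_bound N ξ hM hh ht
  rw [G_eq N ξ hh h0 h2, neg_mul, abs_neg, abs_of_nonneg (mul_nonneg c0 I0)]
  calc _ ≤ cc N α * (M * (1 / (α / 2) + 1 / (1 - α / 2))) := by gcongr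
    _ = (cc N α * (1 / (α / 2) + 1 / (1 - α / 2))) * M := by ring
    _ ≤ _ := by gcongr

lemma Sig_measurable (N : ℕ) (ξ : EuclideanSpace ℝ (Fin N)) (h : ℝ) : Measurable (Sig N ξ h) := by
  have : Sig N ξ h = fun α => -∑' k : {k : Fin N → ℤ // k ≠ 0},
      (2 - 2 * Real.cos (h * latDot N k.1 ξ)) / latNorm N k.1 ^ ((N : ℝ) + α) := by
    ext α
    rw [Sig, ← tsum_neg]
    congr 1; ext k
    ring
  rw [this]
  refine (measurable_tsum_nonneg (fun (k : {k : Fin N → ℤ // k ≠ 0}) α =>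
      (2 - 2 * Real.cos (h * latDot N k.1 ξ)) / latNorm N k.1 ^ ((N : ℝ) + α)) ?_ ?_).neg
  · intro k α
    have : 0 ≤ 2 - 2 * Real.cos (h * latDot N k.1 ξ) := by linarith [Real.cos_le_one (h * latDot N k.1 ξ)]
    have : 0 ≤ latNorm N k.1 := Real.sqrt_nonneg _
    positivity
  · intro k
    fun_prop

lemma Gamma_contOn : ContinuousOn Real.Gamma (Set.Ioi 0) := fun x hx =>
  (Real.differentiableAt_Gamma fun m => by
    have hx : 0 < x := hx
    have : (0 : ℝ) ≤ m := by positivity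
    linarith).continuousAt.continuousWithinAt

lemma bConst_contOn (N : ℕ) : ContinuousOn (bConst N) (Set.Ioi 0) := by
  have hN : (0 : ℝ) ≤ N := by positivity
  have g1 : ContinuousOn (fun α : ℝ => Real.Gamma (α / 2)) (Set.Ioi 0) :=
    Gamma_contOn.comp (by fun_prop) (fun x hx => by simpa using hx)
  have g2 : ContinuousOn (fun α : ℝ => Real.Gamma (((N : ℝ) + α) / 2)) (Set.Ioi 0) :=
    Gamma_contOn.comp (by fun_prop) (fun x hx => by
      have hx : 0 < x := hx
      show 0 < ((N : ℝ) + x) / 2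
      linarith)
  have g3 : Continuous (fun α : ℝ => (2 : ℝ) ^ ((2 : ℝ) - α) * Real.pi ^ (1 + (N : ℝ) / 2)) := by
    have : Continuous (fun α : ℝ => (2 : ℝ) ^ ((2 : ℝ) - α)) :=
      (Real.continuous_const_rpow (by norm_num)).comp (by fun_prop)
    fun_prop
  unfold bConst
  refine ContinuousOn.div (by fun_prop) g3.continuousOn fun x _ => ?_
  have := Real.pi_pos
  positivity
/-- For a nonnegative integrable weight `a` supported in `(0,2)`, the `α`-integrated lattice
approximation converges to the symbol of the distributed order operator:
`∫₀² a(α) b(α) h^{-α} (∑_{k≠0} (2cos(h k·ξ)-2)/|k|^{N+α}) dα → -∫₀² a(α)|ξ|^α dα` as `h → 0⁺`. -/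
theorem stmt_3 (N : ℕ) (hN : 1 ≤ N) (a : ℝ → ℝ)
    (ha_meas : Measurable a) (ha_nonneg : ∀ s, 0 ≤ a s)
    (ha_supp : ∀ s, s ∉ Set.Ioo (0 : ℝ) 2 → a s = 0) (ha_int : Integrable a)
    (ξ : EuclideanSpace ℝ (Fin N)) :
    Tendsto (fun h : ℝ =>
        ∫ α in (0 : ℝ)..2,
          a α * bConst N α * h ^ (-α) *
            ∑' k : {k : Fin N → ℤ // k ≠ 0},
              (2 * Real.cos (h * latDot N k.1 ξ) - 2) / latNorm N k.1 ^ ((N : ℝ) + α))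
      (𝓝[>] 0) (𝓝 (-∫ α in (0 : ℝ)..2, a α * ‖ξ‖ ^ α)) := by
  obtain ⟨B, hB⟩ := G_bound N ξ
  rw [← intervalIntegral.integral_neg]
  refine intervalIntegral.tendsto_integral_filter_of_dominated_convergence (fun α => a α * B) ?_ ?_ ?_ ?_
  · refine Eventually.of_forall fun h => ?_
    have hb : AEStronglyMeasurable (bConst N) (volume.restrict (Set.uIoc 0 2)) := by
      refine ((bConst_contOn N).mono ?_).aestronglyMeasurable measurableSet_uIoc
      intro x hx
      rw [Set.uIoc_of_le (by norm_num)] at hx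
      exact hx.1
    have hr : Measurable fun α : ℝ => h ^ (-α) := by fun_prop
    exact ((ha_meas.aestronglyMeasurable.mul hb).mul hr.aestronglyMeasurable).mul
      (Sig_measurable N ξ h).aestronglyMeasurable
  · filter_upwards [self_mem_nhdsWithin] with h hh
    refine Eventually.of_forall fun α _ => ?_
    by_cases hα : α ∈ Set.Ioo (0 : ℝ) 2
    · have := hB h α hh hα.1 hα.2
      have e : a α * bConst N α * h ^ (-α) * Sig N ξ h α = a α * (bConst N α * h ^ (-α) * Sig N ξ h α) := by ring
      change ‖a α * bConst N α * h ^ (-α) * Sig N ξ h α‖ ≤ _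
      rw [e, Real.norm_eq_abs, abs_mul, abs_of_nonneg (ha_nonneg α)]
      exact mul_le_mul_of_nonneg_left this (ha_nonneg α)
    · simp [ha_supp α hα]
  · exact (ha_int.mul_const B).intervalIntegrable
  · refine Eventually.of_forall fun α _ => ?_
    by_cases hα : α ∈ Set.Ioo (0 : ℝ) 2
    · have := (G_tendsto N ξ hα.1 hα.2).const_mul (a α)
      rw [mul_neg] at this
      refine this.congr fun h => ?_
      change _ = a α * bConst N α * h ^ (-α) * Sig N ξ h α
      ring
    · simp [ha_supp α hα]
end
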